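/- Fix σ > 0. For c > 0, an integer k ≥ 1, and μ > 0, define N_k(μ) := #{n ∈ ℤ : n ≥ c·k and (n, k − 3/4) ∈ μD} and N_k′(μ) := #{n ∈ ℤ : n ≥ c·k and #{t ∈ (0,μ] : φ_{n,σ}(t) = 0} ≥ k}. Then there exists c₀ > 0 such that for every c ≥ c₀ there is a constant C > 0 with N_k(μ) − C·μ^{1/3}·k^{−4/3} − 1 ≤ N_k′(μ) ≤ N_k(μ) + C·μ^{1/3}·k^{−4/3} + 1 for all integers k ≥ 1 and all μ ≥ 1. -/

import Mathlib

open Real MeasureTheory Pointwise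

/-- The Bessel function of integer order `n`: `J_n(x) = (1/π)∫₀^π cos(x sin t − n t) dt`. -/
noncomputable def besselJ (n : ℕ) (x : ℝ) : ℝ :=
  (1 / π) * ∫ t in (0:ℝ)..π, Real.cos (x * Real.sin t - n * t)

/-- The derivative `J_n′` of the Bessel function. -/
noncomputable def besselJ' (n : ℕ) (x : ℝ) : ℝ := deriv (besselJ n) x

/-- `φ_{n,σ}(x) = x·J_n′(x) + σ·J_n(x)`. -/
noncomputable def phiRobin (σ : ℝ) (n : ℕ) (x : ℝ) : ℝ :=
  x * besselJ' n x + σ * besselJ n x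

/-- `g(x) = (1/π)(√(1−x²) − x·arccos x)`. -/
noncomputable def gfun (x : ℝ) : ℝ :=
  (1 / π) * (Real.sqrt (1 - x ^ 2) - x * Real.arccos x)

/-- The cusped domain `D = {(x,y) : −1 ≤ x ≤ 1, max(0,−x) ≤ y ≤ g(x)}`. -/
def domD : Set (ℝ × ℝ) :=
  {p | -1 ≤ p.1 ∧ p.1 ≤ 1 ∧ max 0 (-p.1) ≤ p.2 ∧ p.2 ≤ gfun p.1}

/-- `N_k(μ) = #{n ∈ ℤ : n ≥ c·k, (n, k − 3/4) ∈ μD}`. -/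
noncomputable def latticeCountRow (c : ℝ) (k : ℕ) (μ : ℝ) : ℕ :=
  ({n : ℤ | c * (k : ℝ) ≤ (n : ℝ) ∧ ((n : ℝ), (k : ℝ) - 3/4) ∈ μ • domD}).ncard

/-- `N_k′(μ) = #{n ∈ ℤ : n ≥ c·k, #{t ∈ (0,μ] : φ_{n,σ}(t) = 0} ≥ k}`. -/
noncomputable def diskRobinCountRow (σ c : ℝ) (k : ℕ) (μ : ℝ) : ℕ :=
  ({n : ℤ | c * (k : ℝ) ≤ (n : ℝ) ∧
    k ≤ ({t : ℝ | t ∈ Set.Ioc 0 μ ∧ phiRobin σ n.natAbs t = 0}).ncard}).ncard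


lemma deriv_under (F F' : ℝ → ℝ → ℝ) (hF : ∀ x, Continuous (F x)) (hF' : ∀ x, Continuous (F' x))
    (hd : ∀ x t, HasDerivAt (fun x => F x t) (F' x t) x) (hb : ∀ x t, |F' x t| ≤ 1) (x : ℝ) :
    HasDerivAt (fun x => ∫ t in (0:ℝ)..π, F x t) (∫ t in (0:ℝ)..π, F' x t) x := by
  refine (intervalIntegral.hasDerivAt_integral_of_dominated_loc_of_deriv_le
    (s := Set.univ) (bound := fun _ => 1) Filter.univ_mem ?_ ?_ ?_ ?_ ?_ ?_).2
  · exact Filter.Eventually.of_forall fun y => (hF y).aestronglyMeasurable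
  · exact (hF x).intervalIntegrable _ _
  · exact (hF' x).aestronglyMeasurable
  · exact Filter.Eventually.of_forall fun t _ y _ => hb y t
  · exact continuous_const.intervalIntegrable _ _
  · exact Filter.Eventually.of_forall fun t _ y _ => hd y t

lemma sub_hd (n : ℕ) (x t : ℝ) :
    HasDerivAt (fun x : ℝ => x * Real.sin t - n * t) (Real.sin t) x := by
  simpa using ((hasDerivAt_id x).mul_const (Real.sin t)).sub_const ((n:ℝ) * t)

noncomputable def bJ1 (n : ℕ) (x : ℝ) : ℝ :=
  (1 / π) * ∫ t in (0:ℝ)..π, -Real.sin (x * Real.sin t - n * t) * Real.sin t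

lemma bJ_hd (n : ℕ) (x : ℝ) : HasDerivAt (besselJ n) (bJ1 n x) x := by
  unfold besselJ bJ1
  refine HasDerivAt.const_mul _ (deriv_under (fun x t => Real.cos (x * Real.sin t - n * t))
    (fun x t => -Real.sin (x * Real.sin t - n * t) * Real.sin t) ?_ ?_ ?_ ?_ x)
  · intro x; fun_prop
  · intro x; fun_prop
  · intro x t; exact (sub_hd n x t).cos
  · intro x t
    rw [abs_mul, abs_neg]
    exact mul_le_one₀ (abs_sin_le_one _) (abs_nonneg _) (abs_sin_le_one _)

lemma bJ1_hd (n : ℕ) (x : ℝ) : HasDerivAt (bJ1 n) ((1 / π) * ∫ t in (0:ℝ)..π,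
    -(Real.cos (x * Real.sin t - n * t) * Real.sin t) * Real.sin t) x := by
  unfold bJ1
  refine HasDerivAt.const_mul _ (deriv_under
    (fun x t => -Real.sin (x * Real.sin t - n * t) * Real.sin t)
    (fun x t => -(Real.cos (x * Real.sin t - n * t) * Real.sin t) * Real.sin t) ?_ ?_ ?_ ?_ x)
  · intro x; fun_prop
  · intro x; fun_prop
  · intro x t; exact ((sub_hd n x t).sin.neg).mul_const _
  · intro x t
    rw [abs_mul, abs_neg, abs_mul]
    exact mul_le_one₀ (mul_le_one₀ (abs_cos_le_one _) (abs_nonneg _) (abs_sin_le_one _))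
      (abs_nonneg _) (abs_sin_le_one _)

lemma bJ_ode_int (n : ℕ) (x : ℝ) :
    ∫ t in (0:ℝ)..π, ((x * Real.cos t + n) * (x * Real.cos t - n) * Real.cos (x * Real.sin t - n * t)
      - x * Real.sin t * Real.sin (x * Real.sin t - n * t)) = 0 := by
  have h : ∀ t ∈ Set.uIcc (0:ℝ) π, HasDerivAt
      (fun t => (x * Real.cos t + n) * Real.sin (x * Real.sin t - n * t))
      ((x * Real.cos t + n) * (x * Real.cos t - n) * Real.cos (x * Real.sin t - n * t)
      - x * Real.sin t * Real.sin (x * Real.sin t - n * t)) t := by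
    intro t _
    have h1 : HasDerivAt (fun t : ℝ => x * Real.sin t - n * t) (x * Real.cos t - n) t := by
      simpa using ((Real.hasDerivAt_sin t).const_mul x).fun_sub ((hasDerivAt_id t).const_mul (n:ℝ))
    have h2 : HasDerivAt (fun t : ℝ => x * Real.cos t + n) (x * -Real.sin t) t :=
      ((Real.hasDerivAt_cos t).const_mul x).add_const _
    refine (h2.fun_mul h1.sin).congr_deriv ?_
    ring
  rw [intervalIntegral.integral_eq_sub_of_hasDerivAt h]
  · have : Real.sin (-(n * π)) = 0 := by rw [Real.sin_neg, Real.sin_nat_mul_pi, neg_zero]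
    simp [this]
  · exact Continuous.intervalIntegrable (by fun_prop) _ _

lemma bJ_z_hd (n : ℕ) (x : ℝ) (hx : 0 < x) :
    HasDerivAt (fun x => x * bJ1 n x) (-(x ^ 2 - (n:ℝ) ^ 2) / x * besselJ n x) x := by
  have h := (hasDerivAt_id x).fun_mul (bJ1_hd n x)
  refine h.congr_deriv ?_
  have h0 := bJ_ode_int n x
  unfold bJ1 besselJ
  simp only [id]
  have e : ∀ t, ((x * Real.cos t + n) * (x * Real.cos t - n) * Real.cos (x * Real.sin t - n * t)
      - x * Real.sin t * Real.sin (x * Real.sin t - n * t)) =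
      (x^2-n^2) * Real.cos (x * Real.sin t - n * t)
       + x * (-Real.sin (x * Real.sin t - n * t) * Real.sin t)
       + x^2 * (-(Real.cos (x * Real.sin t - n * t) * Real.sin t) * Real.sin t) := by
    intro t
    have := Real.sin_sq_add_cos_sq t
    have : Real.cos t ^ 2 = 1 - Real.sin t ^ 2 := by linarith
    ring_nf
    rw [this]; ring
  simp_rw [e] at h0
  rw [intervalIntegral.integral_add, intervalIntegral.integral_add] at h0
  rotate_left
  iterate 4 exact Continuous.intervalIntegrable (by fun_prop) _ _
  simp only [intervalIntegral.integral_const_mul] at h0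
  generalize (∫ t in (0:ℝ)..π, -(Real.cos (x * Real.sin t - n * t) * Real.sin t) * Real.sin t) = A at *
  generalize (∫ t in (0:ℝ)..π, -Real.sin (x * Real.sin t - n * t) * Real.sin t) = B at *
  generalize (∫ t in (0:ℝ)..π, Real.cos (x * Real.sin t - n * t)) = D at *
  field_simp
  linear_combination h0

lemma bJ_abs_le (n : ℕ) (x : ℝ) : |besselJ n x| ≤ 1 := by
  unfold besselJ
  rw [abs_mul, abs_of_pos (by positivity : 0 < 1 / π)]
  have := intervalIntegral.norm_integral_le_of_norm_le_const (a := 0) (b := π) (C := 1)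
    (f := fun t => Real.cos (x * Real.sin t - n * t)) (fun t _ => abs_cos_le_one _)
  rw [Real.norm_eq_abs] at this
  simp only [sub_zero, abs_of_pos Real.pi_pos] at this
  calc _ ≤ 1 / π * (1 * π) := by gcongr
    _ = 1 := by field_simp

lemma phi_eq (σ : ℝ) (n : ℕ) (x : ℝ) :
    phiRobin σ n x = x * bJ1 n x + σ * besselJ n x := by
  unfold phiRobin besselJ'
  rw [(bJ_hd n x).deriv]


lemma fres_tail (b : ℂ) (hb : 1 ≤ ‖b‖) (hre : 0 ≤ b.re) (R M : ℝ) (hR : 0 < R) (hRM : R ≤ M) :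
    ‖∫ v in R..M, Complex.exp (-b * (v:ℂ) ^ 2)‖ ≤ 1 / R := by
  have hb0 : b ≠ 0 := by rintro rfl; simp at hb; linarith
  have hexp : ∀ v : ℝ, ‖Complex.exp (-b * (v:ℂ) ^ 2)‖ ≤ 1 := by
    intro v
    rw [Complex.norm_exp]
    have : (-b * (v:ℂ) ^ 2).re = -(b.re * v ^ 2) := by
      rw [← Complex.ofReal_pow, Complex.re_mul_ofReal]; simp
    rw [this]
    exact Real.exp_le_one_iff.2 (by nlinarith [mul_nonneg hre (sq_nonneg v)])
  have hM : 0 < M := lt_of_lt_of_le hR hRM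
  have hpos : ∀ v ∈ Set.uIcc R M, 0 < v := by
    intro v hv; rw [Set.uIcc_of_le hRM] at hv; exact lt_of_lt_of_le hR hv.1
  have hd : ∀ v ∈ Set.uIcc R M, HasDerivAt (fun v : ℝ => Complex.exp (-b * (v:ℂ) ^ 2) * (-(1 / (2 * b * v))))
      (Complex.exp (-b * (v:ℂ) ^ 2) + Complex.exp (-b * (v:ℂ) ^ 2) * (1 / (2 * b * (v:ℂ) ^ 2))) v := by
    intro v hv
    have hv0 : (v:ℂ) ≠ 0 := by exact_mod_cast (hpos v hv).ne'
    have h1 : HasDerivAt (fun v : ℂ => Complex.exp (-b * v ^ 2) * (-(1 / (2 * b * v))))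
      (Complex.exp (-b * (v:ℂ) ^ 2) + Complex.exp (-b * (v:ℂ) ^ 2) * (1 / (2 * b * (v:ℂ) ^ 2))) v := by
      have e1 := (((hasDerivAt_id (v:ℂ)).pow 2).const_mul (-b)).cexp
      have e2 := (((hasDerivAt_id (v:ℂ)).const_mul (2 * b)).inv (by simp [hb0, hv0])).neg
      refine ((e1.mul e2).congr_of_eventuallyEq ?_).congr_deriv ?_
      · exact Filter.Eventually.of_forall fun w => by simp
      · simp; field_simp
    exact h1.comp_ofReal
  have hc : ContinuousOn (fun v : ℝ => Complex.exp (-b * (v:ℂ) ^ 2) * (1 / (2 * b * (v:ℂ) ^ 2))) (Set.uIcc R M) := by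
    apply ContinuousOn.mul (by fun_prop)
    apply ContinuousOn.div (by fun_prop) (by fun_prop)
    intro v hv
    have hv0 : (v:ℂ) ≠ 0 := by exact_mod_cast (hpos v hv).ne'
    simp [hb0, hv0]
  have hc0 : Continuous (fun v : ℝ => Complex.exp (-b * (v:ℂ) ^ 2)) := by fun_prop
  have key := intervalIntegral.integral_eq_sub_of_hasDerivAt hd
    ((hc0.continuousOn.add hc).intervalIntegrable)
  rw [intervalIntegral.integral_add (hc0.intervalIntegrable _ _) hc.intervalIntegrable] at key
  have hb2 : ∀ v : ℝ, 0 < v → ‖Complex.exp (-b * (v:ℂ) ^ 2) * (-(1 / (2 * b * v)))‖ ≤ 1 / (2 * v) := by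
    intro v hv
    rw [norm_mul, norm_neg, norm_div, norm_one, norm_mul, norm_mul]
    simp only [Complex.norm_real, Complex.norm_ofNat, Real.norm_eq_abs, abs_of_pos hv]
    calc _ ≤ 1 * (1 / (2 * ‖b‖ * v)) := by gcongr; exact hexp v
      _ ≤ 1 * (1 / (2 * 1 * v)) := by gcongr
      _ = _ := by ring
  have hI : ‖∫ v in R..M, Complex.exp (-b * (v:ℂ) ^ 2) * (1 / (2 * b * (v:ℂ) ^ 2))‖ ≤ 1 / (2*R) - 1/(2*M) := by
    have hdd : ∀ v ∈ Set.uIcc R M, HasDerivAt (fun v : ℝ => -(1 / (2 * v))) (1 / (2 * v ^ 2)) v := by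
      intro v hv
      have hv0 := (hpos v hv).ne'
      refine ((((hasDerivAt_id v).const_mul 2).inv (by simp [hv0])).neg.congr_of_eventuallyEq ?_).congr_deriv ?_
      · exact Filter.Eventually.of_forall fun w => by simp
      · simp; field_simp
    have hci : IntervalIntegrable (fun v : ℝ => 1 / (2 * v ^ 2)) volume R M := by
      apply ContinuousOn.intervalIntegrable
      apply ContinuousOn.div (by fun_prop) (by fun_prop)
      intro v hv
      have hv0 := (hpos v hv).ne'
      positivity
    have e := intervalIntegral.integral_eq_sub_of_hasDerivAt hdd hci
    have : (1:ℝ) / (2*R) - 1/(2*M) = ∫ v in R..M, 1 / (2 * v ^ 2) := by rw [e]; ring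
    rw [this]
    apply intervalIntegral.norm_integral_le_of_norm_le hRM _ hci
    refine Filter.Eventually.of_forall fun v hv => ?_
    have hv0 : 0 < v := hR.trans hv.1
    rw [norm_mul, norm_div, norm_one, norm_mul, norm_mul, norm_pow]
    simp only [Complex.norm_real, Complex.norm_ofNat, Real.norm_eq_abs, abs_of_pos hv0]
    calc _ ≤ 1 * (1 / (2 * ‖b‖ * v^2)) := by gcongr; exact hexp v
      _ ≤ 1 * (1 / (2 * 1 * v^2)) := by gcongr
      _ = _ := by ring
  have : (∫ v in R..M, Complex.exp (-b * (v:ℂ) ^ 2)) =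
     Complex.exp (-b * (M:ℂ) ^ 2) * (-(1 / (2 * b * M))) - Complex.exp (-b * (R:ℂ) ^ 2) * (-(1 / (2 * b * R)))
      - ∫ v in R..M, Complex.exp (-b * (v:ℂ) ^ 2) * (1 / (2 * b * (v:ℂ) ^ 2)) := by
    rw [← key]; ring
  rw [this]
  refine (norm_sub_le _ _).trans ?_
  have h1 := (norm_sub_le (Complex.exp (-b * (M:ℂ) ^ 2) * (-(1 / (2 * b * M)))) (Complex.exp (-b * (R:ℂ) ^ 2) * (-(1 / (2 * b * R)))))
  have h2 := hb2 M hM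
  have h3 := hb2 R hR
  have : 1 / R = 1/(2*R) + 1/(2*R) := by field_simp; ring
  linarith

lemma fres_eps (ε : ℝ) (hε : 0 < ε) (R : ℝ) (hR : 0 < R) :
    ‖(∫ v in (0:ℝ)..R, Complex.exp (-(ε + Complex.I) * (v:ℂ) ^ 2)) - (π / (ε + Complex.I)) ^ (1/2:ℂ) / 2‖ ≤ 1 / R := by
  set b : ℂ := ε + Complex.I with hbdef
  have hre : b.re = ε := by simp [hbdef]
  have him : b.im = 1 := by simp [hbdef]
  have hb1 : 1 ≤ ‖b‖ := by
    have := Complex.abs_im_le_norm b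
    rw [him] at this; simpa using this
  have hg := integral_gaussian_complex_Ioi (b := b) (by rw [hre]; exact hε)
  have hint : Integrable (fun v : ℝ => Complex.exp (-b * (v:ℂ) ^ 2)) :=
    integrable_cexp_neg_mul_sq (by rw [hre]; exact hε)
  have ht := intervalIntegral_tendsto_integral_Ioi 0 hint.integrableOn Filter.tendsto_id
  rw [hg] at ht
  have : Filter.Tendsto (fun M : ℝ => ‖(∫ v in (0:ℝ)..R, Complex.exp (-b * (v:ℂ) ^ 2)) - ∫ v in (0:ℝ)..M, Complex.exp (-b * (v:ℂ) ^ 2)‖) Filter.atTop (nhds ‖(∫ v in (0:ℝ)..R, Complex.exp (-b * (v:ℂ) ^ 2)) - (π / b) ^ (1/2:ℂ) / 2‖) :=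
    (tendsto_const_nhds.sub ht).norm
  refine le_of_tendsto this ?_
  filter_upwards [Filter.eventually_ge_atTop R] with M hM
  rw [norm_sub_rev, intervalIntegral.integral_interval_sub_left]
  · exact fres_tail b hb1 (by rw [hre]; exact hε.le) R M hR hM
  · exact hint.intervalIntegrable
  · exact hint.intervalIntegrable

lemma fres_zero (R : ℝ) (hR : 0 < R) :
    ‖(∫ v in (0:ℝ)..R, Complex.exp (-Complex.I * (v:ℂ) ^ 2)) - (π / Complex.I) ^ (1/2:ℂ) / 2‖ ≤ 1 / R := by
  have hc : Continuous (fun ε : ℝ => ∫ v in (0:ℝ)..R, Complex.exp (-(ε + Complex.I) * (v:ℂ) ^ 2)) := by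
    apply intervalIntegral.continuous_parametric_intervalIntegral_of_continuous'
    fun_prop
  have hc2 : ContinuousAt (fun ε : ℝ => (π / ((ε:ℂ) + Complex.I)) ^ (1/2:ℂ) / 2) 0 := by
    apply ContinuousAt.div_const
    apply ContinuousAt.cpow
    · apply ContinuousAt.div (by fun_prop) (by fun_prop)
      simp
    · fun_prop
    · simp [Complex.mem_slitPlane_iff, Real.pi_ne_zero]
  have ht : Filter.Tendsto (fun ε : ℝ => ‖(∫ v in (0:ℝ)..R, Complex.exp (-(ε + Complex.I) * (v:ℂ) ^ 2)) - (π / (ε + Complex.I)) ^ (1/2:ℂ) / 2‖)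
      (nhdsWithin 0 (Set.Ioi 0)) (nhds ‖(∫ v in (0:ℝ)..R, Complex.exp (-((0:ℝ) + Complex.I) * (v:ℂ) ^ 2)) - (π / ((0:ℝ) + Complex.I)) ^ (1/2:ℂ) / 2‖) :=
    ((hc.continuousAt.sub hc2).norm).tendsto.mono_left nhdsWithin_le_nhds
  have := le_of_tendsto ht (b := 1 / R) (by
    filter_upwards [self_mem_nhdsWithin] with ε hε
    exact fres_eps ε hε R hR)
  simpa using this

lemma fres_const : ((π:ℂ) / Complex.I) ^ (1/2:ℂ) / 2 = ((√π / 2 : ℝ) : ℂ) * Complex.exp (((-(π/4) : ℝ) : ℂ) * Complex.I) := by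
  have h : (π:ℂ) / Complex.I = (π:ℝ) * (-Complex.I) := by simp
  have h0 : (π:ℂ) / Complex.I ≠ 0 := by simp [Real.pi_ne_zero]
  rw [Complex.cpow_def_of_ne_zero h0, h, Complex.log_ofReal_mul Real.pi_pos (by simp), Complex.log_neg_I]
  have : √π = Real.exp (Real.log π / 2) := by
    rw [Real.exp_half, Real.exp_log Real.pi_pos]
  rw [this]
  push_cast
  rw [div_mul_eq_mul_div, ← Complex.exp_add]
  congr 2
  ring

lemma fres_real (β x : ℝ) (hx : 0 < x) :
    |√x * (∫ v in (0:ℝ)..1, Real.cos (β - x * v ^ 2)) - √π / 2 * Real.cos (β - π/4)| ≤ 1 / √x := by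
  have hs : 0 < √x := Real.sqrt_pos.2 hx
  have h := fres_zero (√x) hs
  have hsub : (∫ v in (0:ℝ)..√x, Complex.exp (-Complex.I * (v:ℂ) ^ 2)) = (√x : ℂ) * ∫ v in (0:ℝ)..1, Complex.exp (((-(x * v ^ 2) : ℝ):ℂ) * Complex.I) := by
    have := intervalIntegral.smul_integral_comp_mul_left (a := 0) (b := 1) (fun v : ℝ => Complex.exp (-Complex.I * (v:ℂ) ^ 2)) (√x)
    simp only [mul_zero, mul_one] at this
    rw [← this, Complex.real_smul]
    congr 1
    apply intervalIntegral.integral_congr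
    intro v _
    simp only
    congr 1
    have : (√x : ℂ) ^ 2 = x := by
      rw [← Complex.ofReal_pow, Real.sq_sqrt hx.le]
    push_cast
    rw [mul_pow, this]; ring
  rw [hsub, fres_const] at h
  have hre : √x * (∫ v in (0:ℝ)..1, Real.cos (β - x * v ^ 2)) - √π / 2 * Real.cos (β - π/4) =
      (Complex.exp ((β:ℂ) * Complex.I) * ((√x : ℂ) * (∫ v in (0:ℝ)..1, Complex.exp (((-(x * v ^ 2) : ℝ):ℂ) * Complex.I)) - ((√π / 2 : ℝ) : ℂ) * Complex.exp (((-(π/4) : ℝ) : ℂ) * Complex.I))).re := by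
    rw [mul_sub, Complex.sub_re]
    congr 1
    · rw [mul_left_comm, Complex.re_ofReal_mul]
      congr 1
      rw [← intervalIntegral.integral_const_mul]
      have h2 := Complex.reCLM.intervalIntegral_comp_comm (a := 0) (b := 1) (μ := volume) (f := fun v : ℝ => Complex.exp ((β:ℂ) * Complex.I) * Complex.exp (((-(x * v ^ 2) : ℝ):ℂ) * Complex.I))
        (Continuous.intervalIntegrable (by fun_prop) _ _)
      simp only [Complex.reCLM_apply] at h2
      rw [← h2]
      apply intervalIntegral.integral_congr
      intro v _
      simp only
      rw [← Complex.exp_add, ← add_mul, ← Complex.ofReal_add, Complex.exp_ofReal_mul_I_re]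
      rfl
    · rw [mul_left_comm, Complex.re_ofReal_mul, ← Complex.exp_add, ← add_mul, ← Complex.ofReal_add, Complex.exp_ofReal_mul_I_re]
      rfl
  rw [hre]
  refine (Complex.abs_re_le_norm _).trans ?_
  rw [norm_mul, Complex.norm_exp_ofReal_mul_I, one_mul]
  exact h


lemma ibp_bound (K : ℝ → ℝ) (hK : ∀ u ∈ Set.Icc 0 (π/2), ContDiffAt ℝ 1 K u) :
    ∃ D : ℝ, ∀ x : ℝ, 0 < x → ∀ α : ℝ,
      |∫ u in (0:ℝ)..(π/2), K u * (Real.sin u * Real.cos (x * Real.cos u - α))| ≤ D / x := by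
  have hp : (0:ℝ) ≤ π/2 := by positivity
  have hKd : ∀ u ∈ Set.uIcc 0 (π/2), HasDerivAt K (deriv K u) u := by
    intro u hu
    rw [Set.uIcc_of_le hp] at hu
    exact ((hK u hu).differentiableAt (by norm_num)).hasDerivAt
  have hKc : ContinuousOn (deriv K) (Set.uIcc 0 (π/2)) := by
    intro u hu
    rw [Set.uIcc_of_le hp] at hu
    have h := (hK u hu).continuousAt_fderiv (by norm_num)
    have : deriv K = fun u => fderiv ℝ K u 1 := by ext u; simp
    rw [this]
    exact (h.clm_apply continuousAt_const).continuousWithinAt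
  obtain ⟨B, hB⟩ := (isCompact_uIcc (a := (0:ℝ)) (b := π/2)).exists_bound_of_continuousOn hKc
  refine ⟨|K (π/2)| + |K 0| + B * (π/2), fun x hx α => ?_⟩
  have hS : ∀ u ∈ Set.uIcc 0 (π/2), HasDerivAt (fun u => -(1/x) * Real.sin (x * Real.cos u - α))
      (Real.sin u * Real.cos (x * Real.cos u - α)) u := by
    intro u _
    have h1 : HasDerivAt (fun u => x * Real.cos u - α) (x * -Real.sin u) u :=
      ((Real.hasDerivAt_cos u).const_mul x).sub_const α
    refine (h1.sin.const_mul (-(1/x))).congr_deriv ?_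
    field_simp
  rw [intervalIntegral.integral_mul_deriv_eq_deriv_mul hKd hS hKc.intervalIntegrable
    (Continuous.intervalIntegrable (by fun_prop) _ _)]
  have hsb : ∀ u, |-(1/x) * Real.sin (x * Real.cos u - α)| ≤ 1/x := by
    intro u
    rw [abs_mul, abs_neg, abs_of_pos (by positivity : 0 < 1/x)]
    have := abs_sin_le_one (x * Real.cos u - α)
    calc _ ≤ 1/x * 1 := by gcongr
      _ = _ := by ring
  have hI : |∫ u in (0:ℝ)..(π/2), deriv K u * (-(1/x) * Real.sin (x * Real.cos u - α))| ≤ (B * (1/x)) * |π/2 - 0| := by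
    rw [← Real.norm_eq_abs]
    apply intervalIntegral.norm_integral_le_of_norm_le_const
    intro u hu
    rw [norm_mul]
    have h1 := hB u (Set.uIoc_subset_uIcc hu)
    exact mul_le_mul h1 (hsb u) (abs_nonneg _) ((norm_nonneg _).trans h1)
  rw [sub_zero, abs_of_nonneg hp] at hI
  have h1 : |K (π/2) * (-(1/x) * Real.sin (x * Real.cos (π/2) - α))| ≤ |K (π/2)| * (1/x) := by
    rw [abs_mul]; gcongr; exact hsb _
  have h2 : |K 0 * (-(1/x) * Real.sin (x * Real.cos 0 - α))| ≤ |K 0| * (1/x) := by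
    rw [abs_mul]; gcongr; exact hsb _
  calc _ ≤ |K (π/2)| * (1/x) + |K 0| * (1/x) + (B * (1/x)) * (π/2) :=
        (abs_sub _ _).trans (add_le_add ((abs_sub _ _).trans (add_le_add h1 h2)) hI)
    _ = _ := by ring

lemma bJ_half (n : ℕ) (x : ℝ) : besselJ n x =
    (2/π) * ∫ u in (0:ℝ)..(π/2), Real.cos (x * Real.cos u - n * π / 2) * Real.cos (n * u) := by
  unfold besselJ
  set f : ℝ → ℝ := fun t => Real.cos (x * Real.sin t - n * t) with hf
  have hc : Continuous f := by fun_prop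
  have h1 : ∫ t in (0:ℝ)..π, f t = (∫ t in (0:ℝ)..(π/2), f t) + ∫ t in (π/2)..π, f t :=
    (intervalIntegral.integral_add_adjacent_intervals (hc.intervalIntegrable _ _) (hc.intervalIntegrable _ _)).symm
  have h2 : ∫ t in (0:ℝ)..(π/2), f t = ∫ u in (0:ℝ)..(π/2), f (π/2 - u) := by
    rw [intervalIntegral.integral_comp_sub_left]; simp
  have h3 : ∫ t in (π/2)..π, f t = ∫ u in (0:ℝ)..(π/2), f (π/2 + u) := by
    rw [intervalIntegral.integral_comp_add_left]; simp
  rw [h1, h2, h3, ← intervalIntegral.integral_add (Continuous.intervalIntegrable (by fun_prop) _ _) (Continuous.intervalIntegrable (by fun_prop) _ _)]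
  have : ∀ u, f (π/2 - u) + f (π/2 + u) = 2 * (Real.cos (x * Real.cos u - n * π / 2) * Real.cos (n * u)) := by
    intro u
    simp only [hf]
    rw [Real.sin_pi_div_two_sub, add_comm (π/2) u, Real.sin_add_pi_div_two]
    have e1 : x * Real.cos u - n * (π/2 - u) = (x * Real.cos u - n * π / 2) + n * u := by ring
    have e2 : x * Real.cos u - n * (u + π/2) = (x * Real.cos u - n * π / 2) - n * u := by ring
    rw [e1, e2, Real.cos_add, Real.cos_sub (x * Real.cos u - n * π / 2)]; ring
  simp_rw [this]
  rw [intervalIntegral.integral_const_mul]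
  ring

lemma half_int (x α : ℝ) :
    ∫ u in (0:ℝ)..(π/2), Real.cos (x * Real.cos u - α) * Real.cos (u/2) =
      √2 * ∫ v in (0:ℝ)..1, Real.cos ((x - α) - x * v ^ 2) := by
  have hd : ∀ u ∈ Set.uIcc (0:ℝ) (π/2), HasDerivAt (fun u => √2 * Real.sin (u/2)) (√2 * (Real.cos (u/2) * (1/2))) u := by
    intro u _
    exact (((hasDerivAt_id u).div_const 2).sin).const_mul _
  have h := intervalIntegral.integral_comp_mul_deriv hd (g := fun v => Real.cos ((x - α) - x * v ^ 2))
    (by fun_prop) (by fun_prop)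
  have e0 : √2 * Real.sin (0/2) = 0 := by simp
  have e1 : √2 * Real.sin (π/2/2) = 1 := by
    rw [show π/2/2 = π/4 by ring, Real.sin_pi_div_four]
    have := Real.mul_self_sqrt (show (0:ℝ) ≤ 2 by norm_num)
    linarith
  rw [e0, e1] at h
  rw [← h, ← intervalIntegral.integral_const_mul]
  apply intervalIntegral.integral_congr
  intro u _
  simp only [Function.comp]
  have h2 : √2 ^ 2 = 2 := Real.sq_sqrt (by norm_num)
  have h3 : Real.cos u = 1 - 2 * Real.sin (u/2) ^ 2 := by
    rw [Real.sin_sq_eq_half_sub]; rw [show 2 * (u/2) = u by ring]; ring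
  rw [show x - α - x * (√2 * Real.sin (u/2)) ^ 2 = x * Real.cos u - α by
    rw [mul_pow, h2, h3]; ring]
  rw [show √2 * (Real.cos (x * Real.cos u - α) * (√2 * (Real.cos (u/2) * (1/2)))) =
    √2 ^ 2 * (Real.cos (x * Real.cos u - α) * ((Real.cos (u/2) * (1/2)))) by ring, h2]
  ring

lemma cos_fact (n : ℕ) : ∃ P : Polynomial ℝ, ∀ u : ℝ, Real.cos (n * u) - 1 = (Real.cos u - 1) * P.eval (Real.cos u) := by
  have h : (Polynomial.Chebyshev.T ℝ (n:ℤ) - 1).IsRoot 1 := by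
    simp [Polynomial.IsRoot]
  obtain ⟨P, hP⟩ := Polynomial.dvd_iff_isRoot.2 h
  refine ⟨P, fun u => ?_⟩
  have := congrArg (Polynomial.eval (Real.cos u)) hP
  have hT := Polynomial.Chebyshev.T_real_cos u (n:ℤ)
  simp at this
  exact this

lemma bJ_asymp (n : ℕ) : ∃ D : ℝ, ∀ x : ℝ, 0 < x →
    |√x * besselJ n x - (2/π) * (√2 * (√π/2)) * Real.cos (x - n * π / 2 - π/4)| ≤ D / √x := by
  obtain ⟨P, hP⟩ := cos_fact n
  have hpos : ∀ u ∈ Set.Icc 0 (π/2), 0 ≤ Real.cos u ∧ 0 ≤ Real.cos (u/2) := by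
    intro u hu
    constructor <;> apply Real.cos_nonneg_of_mem_Icc <;> constructor <;> linarith [hu.1, hu.2, Real.pi_pos]
  set K : ℝ → ℝ := fun u => Real.sin u / (1 + Real.cos u) * (-P.eval (Real.cos u) + 1 / (2 * (1 + Real.cos (u/2)))) with hKdef
  have hK : ∀ u ∈ Set.Icc 0 (π/2), ContDiffAt ℝ 1 K u := by
    intro u hu
    obtain ⟨h1, h2⟩ := hpos u hu
    apply ContDiffAt.mul
    · exact ContDiffAt.div (by fun_prop) (by fun_prop) (by positivity)
    · apply ContDiffAt.add
      · apply ContDiffAt.neg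
        have hPc : ContDiff ℝ 1 (fun x : ℝ => P.eval x) := by
          simpa [Polynomial.coe_aeval_eq_eval] using Polynomial.contDiff_aeval (𝕜 := ℝ) P 1
        exact (hPc.comp Real.contDiff_cos).contDiffAt
      · exact ContDiffAt.div (by fun_prop) (by fun_prop) (by positivity)
  obtain ⟨D, hD⟩ := ibp_bound K hK
  refine ⟨(2/π) * (D + √2), fun x hx => ?_⟩
  set α : ℝ := n * π / 2 with hα
  have hs : 0 < √x := Real.sqrt_pos.2 hx
  have hsplit : ∫ u in (0:ℝ)..(π/2), Real.cos (x * Real.cos u - α) * Real.cos (n * u) =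
      (∫ u in (0:ℝ)..(π/2), K u * (Real.sin u * Real.cos (x * Real.cos u - α))) +
      ∫ u in (0:ℝ)..(π/2), Real.cos (x * Real.cos u - α) * Real.cos (u/2) := by
    rw [← intervalIntegral.integral_add]
    · apply intervalIntegral.integral_congr
      intro u hu
      rw [Set.uIcc_of_le (by positivity)] at hu
      obtain ⟨h1, h2⟩ := hpos u hu
      simp only [hKdef]
      have e1 : Real.cos (n * u) = 1 + (Real.cos u - 1) * P.eval (Real.cos u) := by linarith [hP u]
      have e2 : Real.sin u ^ 2 = (1 - Real.cos u) * (1 + Real.cos u) := by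
        have := Real.sin_sq_add_cos_sq u; linarith
      have e3 : Real.cos u = 2 * Real.cos (u/2) ^ 2 - 1 := by
        rw [← Real.cos_two_mul]; congr 1; ring
      have h3 : 1 + Real.cos u ≠ 0 := by positivity
      have h4 : 1 + Real.cos (u/2) ≠ 0 := by positivity
      have e4 : Real.sin u / (1 + Real.cos u) * Real.sin u = 1 - Real.cos u := by
        field_simp; linarith
      have e5 : (1 - Real.cos u) * (1 / (2 * (1 + Real.cos (u/2)))) = 1 - Real.cos (u/2) := by
        rw [e3]; field_simp; ring
      rw [e1]
      calc _ = Real.cos (x * Real.cos u - α) * (-(1 - Real.cos u) * P.eval (Real.cos u) + (1 - Real.cos (u/2)) + Real.cos (u/2)) := by ring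
        _ = Real.cos (x * Real.cos u - α) * (-(1 - Real.cos u) * P.eval (Real.cos u) + (1 - Real.cos u) * (1 / (2 * (1 + Real.cos (u/2)))) + Real.cos (u/2)) := by rw [e5]
        _ = Real.cos (x * Real.cos u - α) * ((Real.sin u / (1 + Real.cos u) * Real.sin u) * (- P.eval (Real.cos u) + (1 / (2 * (1 + Real.cos (u/2))))) + Real.cos (u/2)) := by rw [e4]; ring
        _ = _ := by ring
    · apply ContinuousOn.intervalIntegrable
      apply ContinuousOn.mul
      · intro u hu
        rw [Set.uIcc_of_le (by positivity)] at hu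
        exact (hK u hu).continuousAt.continuousWithinAt
      · fun_prop
    · exact Continuous.intervalIntegrable (by fun_prop) _ _
  rw [bJ_half, ← hα, hsplit, half_int]
  have h1 := hD x hx α
  have h2 := fres_real (x - α) x hx
  set A := ∫ u in (0:ℝ)..(π/2), K u * (Real.sin u * Real.cos (x * Real.cos u - α))
  set B := ∫ v in (0:ℝ)..1, Real.cos ((x - α) - x * v ^ 2)
  have e : √x * (2/π * (A + √2 * B)) - 2/π * (√2 * (√π/2)) * Real.cos (x - α - π/4) =
    (2/π) * (√x * A + √2 * (√x * B - √π/2 * Real.cos (x - α - π/4))) := by ring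
  rw [e, abs_mul, abs_of_pos (by positivity : 0 < 2/π), mul_div_assoc]
  gcongr
  have h3 : |√x * A| ≤ D / √x := by
    rw [abs_mul, abs_of_pos hs]
    calc _ ≤ √x * (D / x) := by gcongr
      _ = √x * (D / (√x * √x)) := by rw [Real.mul_self_sqrt hx.le]
      _ = _ := by field_simp
  have h4 : |√2 * (√x * B - √π/2 * Real.cos (x - α - π/4))| ≤ √2 * (1/√x) := by
    rw [abs_mul, abs_of_pos (by positivity : 0 < √2)]
    gcongr
  calc _ ≤ D / √x + √2 * (1/√x) := (abs_add_le _ _).trans (add_le_add h3 h4)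
    _ = _ := by ring


lemma bs_uniq (ν : ℝ) (y z : ℝ → ℝ) (hy : ∀ x, 0 < x → HasDerivAt y (z x / x) x)
    (hz : ∀ x, 0 < x → HasDerivAt z (-(x ^ 2 - ν ^ 2) / x * y x) x)
    (x0 X : ℝ) (h0 : 0 < x0) (hX : x0 ≤ X) (hy0 : y x0 = 0) (hz0 : z x0 = 0) : y X = 0 := by
  set K : ℝ := (1 + X ^ 2 + ν ^ 2) / x0 with hK
  set g : ℝ → ℝ := fun x => (y x ^ 2 + z x ^ 2) * Real.exp (-K * x) with hg
  have hd : ∀ x, 0 < x → HasDerivAt g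
      ((2 * y x * (z x / x) + 2 * z x * (-(x ^ 2 - ν ^ 2) / x * y x) - K * (y x ^ 2 + z x ^ 2)) * Real.exp (-K * x)) x := by
    intro x hx
    have h1 := ((hy x hx).fun_pow 2).fun_add ((hz x hx).fun_pow 2)
    have h2 : HasDerivAt (fun x : ℝ => Real.exp (-K * x)) (Real.exp (-K * x) * (-K * 1)) x :=
      ((hasDerivAt_id x).const_mul (-K)).exp
    refine (h1.fun_mul h2).congr_deriv ?_
    simp; ring
  have hanti : AntitoneOn g (Set.Icc x0 X) := by
    apply antitoneOn_of_deriv_nonpos (convex_Icc _ _)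
    · intro x hx
      exact (hd x (h0.trans_le hx.1)).continuousAt.continuousWithinAt
    · intro x hx
      rw [interior_Icc] at hx
      exact (hd x (h0.trans hx.1)).differentiableAt.differentiableWithinAt
    · intro x hx
      rw [interior_Icc] at hx
      have hx0 : 0 < x := h0.trans hx.1
      rw [(hd x hx0).deriv]
      apply mul_nonpos_of_nonpos_of_nonneg _ (Real.exp_pos _).le
      have hA : |(1 - (x ^ 2 - ν ^ 2)) / x| ≤ K := by
        rw [abs_div, abs_of_pos hx0, hK]
        have h1 : |1 - (x ^ 2 - ν ^ 2)| ≤ 1 + X ^ 2 + ν ^ 2 := by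
          have : x ^ 2 ≤ X ^ 2 := by nlinarith [hx.2]
          rw [abs_le]; constructor <;> nlinarith [sq_nonneg x, sq_nonneg ν]
        exact div_le_div₀ (by positivity) h1 h0 hx.1.le
      have hB : 2 * y x * (z x / x) + 2 * z x * (-(x ^ 2 - ν ^ 2) / x * y x) = (2 * y x * z x) * ((1 - (x ^ 2 - ν ^ 2)) / x) := by
        field_simp; ring
      rw [hB]
      have h3 : |2 * y x * z x| ≤ y x ^ 2 + z x ^ 2 := by
        rw [abs_le]; constructor <;> nlinarith [sq_nonneg (y x - z x), sq_nonneg (y x + z x)]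
      have h4 : (2 * y x * z x) * ((1 - (x ^ 2 - ν ^ 2)) / x) ≤ (y x ^ 2 + z x ^ 2) * K := by
        refine (le_abs_self _).trans ?_
        rw [abs_mul]
        exact mul_le_mul h3 hA (abs_nonneg _) (by positivity)
      linarith
  have h := hanti (Set.left_mem_Icc.2 hX) (Set.right_mem_Icc.2 hX) hX
  simp only [hg, hy0, hz0] at h
  have h5 : (y X ^ 2 + z X ^ 2) ≤ 0 := by
    by_contra hc
    push Not at hc
    have := mul_pos hc (Real.exp_pos (-K * X))
    simp only [ne_eq, OfNat.ofNat_ne_zero, not_false_eq_true, zero_pow, add_zero, zero_mul] at h; linarith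
  nlinarith [sq_nonneg (y X), sq_nonneg (z X)]

/-- Abstract Bessel system. -/
structure BSys (ν : ℝ) (y z : ℝ → ℝ) : Prop where
  hν : 1 ≤ ν
  hy : ∀ x, 0 < x → HasDerivAt y (z x / x) x
  hz : ∀ x, 0 < x → HasDerivAt z (-(x ^ 2 - ν ^ 2) / x * y x) x
  hnt : ∀ x, 0 < x → y x = 0 → z x = 0 → False
  hG : ∀ x, 0 < x → x ≤ ν → 0 ≤ y x * z x
  hyν : 0 < y ν
  hzν : 0 ≤ z ν
  has : ∃ A D : ℝ, ∀ x, 0 < x → |√x * y x - A * Real.cos (x - ν * π / 2 - π / 4)| ≤ D / √x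

lemma bs_G (ν : ℝ) (y z : ℝ → ℝ) (hy : ∀ x, 0 < x → HasDerivAt y (z x / x) x)
    (hz : ∀ x, 0 < x → HasDerivAt z (-(x ^ 2 - ν ^ 2) / x * y x) x)
    (hb : ∀ x, |y x| ≤ 1) (x0 : ℝ) (h0 : 0 < x0) (hX : x0 ≤ ν) : 0 ≤ y x0 * z x0 := by
  by_contra hneg
  push Not at hneg
  have hGd : ∀ x, 0 < x → HasDerivAt (fun x => y x * z x) (z x ^ 2 / x + (ν ^ 2 - x ^ 2) / x * y x ^ 2) x := by
    intro x hx
    refine ((hy x hx).fun_mul (hz x hx)).congr_deriv ?_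
    field_simp; ring
  have hmono : MonotoneOn (fun x => y x * z x) (Set.Ioc 0 ν) := by
    apply monotoneOn_of_deriv_nonneg (convex_Ioc _ _)
    · intro x hx; exact (hGd x hx.1).continuousAt.continuousWithinAt
    · intro x hx; rw [interior_Ioc] at hx
      exact (hGd x hx.1).differentiableAt.differentiableWithinAt
    · intro x hx; rw [interior_Ioc] at hx
      rw [(hGd x hx.1).deriv]
      have h1 := hx.1
      have : 0 ≤ ν ^ 2 - x ^ 2 := by nlinarith [hx.1, hx.2]
      positivity
  set g := -(y x0 * z x0) with hgdef
  have hg : 0 < g := by linarith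
  have hLd : ∀ x, 0 < x → HasDerivAt (fun x => y x ^ 2 + 2 * g * Real.log x) (2 * (y x * z x + g) / x) x := by
    intro x hx
    refine (((hy x hx).fun_pow 2).fun_add ((Real.hasDerivAt_log hx.ne').const_mul (2*g))).congr_deriv ?_
    simp; field_simp
  have hanti : AntitoneOn (fun x => y x ^ 2 + 2 * g * Real.log x) (Set.Ioc 0 x0) := by
    apply antitoneOn_of_deriv_nonpos (convex_Ioc _ _)
    · intro x hx; exact (hLd x hx.1).continuousAt.continuousWithinAt
    · intro x hx; rw [interior_Ioc] at hx
      exact (hLd x hx.1).differentiableAt.differentiableWithinAt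
    · intro x hx; rw [interior_Ioc] at hx
      rw [(hLd x hx.1).deriv]
      have := hmono ⟨hx.1, hx.2.le.trans hX⟩ ⟨h0, hX⟩ hx.2.le
      simp only at this
      apply div_nonpos_of_nonpos_of_nonneg _ hx.1.le
      linarith
  -- evaluate at small x
  set x := x0 * Real.exp (-(1 / g)) with hxdef
  have hx : 0 < x := by positivity
  have hxx : x ≤ x0 := by
    have : Real.exp (-(1/g)) ≤ 1 := Real.exp_le_one_iff.2 (by have := one_div_pos.2 hg; linarith)
    nlinarith
  have h := hanti ⟨hx, hxx⟩ ⟨h0, le_rfl⟩ hxx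
  simp only at h
  rw [hxdef, Real.log_mul h0.ne' (Real.exp_ne_zero _), Real.log_exp, ← hxdef] at h
  have h1 : y x ^ 2 ≤ 1 := by
    have := hb x; rw [abs_le] at this; nlinarith
  have h2 : 2 * g * (-(1/g)) = -2 := by field_simp
  nlinarith [sq_nonneg (y x0)]

lemma bessel_BSys (n : ℕ) (hn : 1 ≤ n) : ∃ ε : ℝ, ε ≠ 0 ∧
    BSys n (fun x => ε * besselJ n x) (fun x => ε * (x * bJ1 n x)) := by
  have hn' : (1:ℝ) ≤ n := by exact_mod_cast hn
  set y := besselJ n with hydef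
  set z := fun x => x * bJ1 n x with hzdef
  have hy : ∀ x, 0 < x → HasDerivAt y (z x / x) x := by
    intro x hx
    refine (bJ_hd n x).congr_deriv ?_
    simp only [hzdef]; field_simp
  have hz : ∀ x, 0 < x → HasDerivAt z (-(x ^ 2 - (n:ℝ) ^ 2) / x * y x) x := fun x hx => bJ_z_hd n x hx
  obtain ⟨D, hD⟩ := bJ_asymp n
  rw [← hydef] at hD
  set A : ℝ := (2/π) * (√2 * (√π/2)) with hA
  have hApos : 0 < A := by positivity
  have hnt : ∀ x, 0 < x → y x = 0 → z x = 0 → False := by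
    intro x0 h0 hy0 hz0
    have hall : ∀ X, x0 ≤ X → y X = 0 := fun X hX => bs_uniq n y z hy hz x0 X h0 hX hy0 hz0
    obtain ⟨m, hm⟩ := exists_nat_ge (max x0 ((|D|/A + 1)^2))
    set X : ℝ := n * π / 2 + π / 4 + m * (2 * π) with hXd
    have hXm : (m:ℝ) ≤ X := by
      have : (m:ℝ) * 1 ≤ m * (2 * π) := by gcongr; linarith [Real.pi_gt_three]
      have : 0 ≤ (n:ℝ) * π / 2 + π/4 := by positivity
      linarith
    have hx0X : x0 ≤ X := (le_max_left _ _).trans (hm.trans hXm)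
    have h1 := hD X (h0.trans_le hx0X)
    rw [hall X hx0X] at h1
    have h2 : Real.cos (X - n * π / 2 - π / 4) = 1 := by
      rw [hXd, show (n:ℝ) * π / 2 + π / 4 + m * (2 * π) - n * π / 2 - π / 4 = m * (2 * π) by ring]
      exact Real.cos_nat_mul_two_pi m
    rw [h2] at h1
    simp only [mul_zero, zero_sub, mul_one, abs_neg, abs_of_pos hApos] at h1
    have h3 : |D|/A + 1 ≤ √X := Real.le_sqrt_of_sq_le ((le_max_right _ _).trans (hm.trans hXm))
    have hpos : 0 < |D|/A + 1 := by positivity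
    have h4 : A * √X ≤ D := by
      rwa [le_div_iff₀ (hpos.trans_le h3)] at h1
    have h5 : A * (|D|/A + 1) ≤ A * √X := by gcongr
    have h6 : A * (|D|/A + 1) = |D| + A := by field_simp
    linarith [le_abs_self D]
  have hG : ∀ x : ℝ, 0 < x → x ≤ n → 0 ≤ y x * z x := fun x h0 h1 =>
    bs_G n y z hy hz (bJ_abs_le n) x h0 h1
  have hnp : (0:ℝ) < n := by linarith
  have hyn : y n ≠ 0 := by
    intro h
    have hmono : MonotoneOn (fun x => y x ^ 2) (Set.Ioc 0 (n:ℝ)) := by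
      have hd : ∀ x, 0 < x → HasDerivAt (fun x => y x ^ 2) (2 * (y x * z x) / x) x := by
        intro x hx
        refine ((hy x hx).fun_pow 2).congr_deriv ?_
        simp; ring
      apply monotoneOn_of_deriv_nonneg (convex_Ioc _ _)
      · intro x hx; exact (hd x hx.1).continuousAt.continuousWithinAt
      · intro x hx; rw [interior_Ioc] at hx
        exact (hd x hx.1).differentiableAt.differentiableWithinAt
      · intro x hx; rw [interior_Ioc] at hx
        rw [(hd x hx.1).deriv]
        have := hG x hx.1 hx.2.le
        have := hx.1
        positivity
    have hzero : ∀ x : ℝ, 0 < x → x ≤ n → y x = 0 := by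
      intro x h0 h1
      have := hmono ⟨h0, h1⟩ ⟨hnp, le_rfl⟩ h1
      simp only [h] at this
      nlinarith [sq_nonneg (y x)]
    have hev : y =ᶠ[nhds ((n:ℝ)/2)] fun _ => 0 := by
      filter_upwards [Ioo_mem_nhds (show (0:ℝ) < n/2 by linarith) (show (n:ℝ)/2 < n by linarith)] with x hx
      exact hzero x hx.1 hx.2.le
    have hd1 := (hy (n/2) (by linarith))
    have hd2 : HasDerivAt y 0 ((n:ℝ)/2) := (hasDerivAt_const _ (0:ℝ)).congr_of_eventuallyEq hev
    have := hd1.unique hd2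
    have hz0 : z (n/2) = 0 := by
      rw [div_eq_zero_iff] at this
      rcases this with h | h
      · exact h
      · linarith
    exact hnt (n/2) (by linarith) (hzero _ (by linarith) (by linarith)) hz0
  refine ⟨y n, hyn, hn', ?_, ?_, ?_, ?_, ?_, ?_, ?_⟩
  · intro x hx
    refine ((hy x hx).const_mul (y n)).congr_deriv ?_
    simp only [hzdef]; ring
  · intro x hx
    refine ((hz x hx).const_mul (y n)).congr_deriv ?_
    ring
  · intro x hx h1 h2
    exact hnt x hx ((mul_eq_zero.1 h1).resolve_left hyn) ((mul_eq_zero.1 h2).resolve_left hyn)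
  · intro x h0 h1
    have := hG x h0 h1
    have h3 : y n * y x * (y n * z x) = (y n)^2 * (y x * z x) := by ring
    simp only [hzdef] at h3 this ⊢
    rw [h3]; positivity
  · have := mul_self_pos.2 hyn
    exact this
  · exact hG n hnp le_rfl
  · refine ⟨y n * A, |y n| * D, fun x hx => ?_⟩
    have := hD x hx
    rw [show √x * (y n * y x) - y n * A * Real.cos (x - n * π / 2 - π / 4) = y n * (√x * y x - A * Real.cos (x - n * π / 2 - π / 4)) by ring, abs_mul]
    calc _ ≤ |y n| * (D / √x) := mul_le_mul_of_nonneg_left this (abs_nonneg _)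
      _ = _ := by ring


/-- lifting of the angle -/
lemma lift_angle (a : ℝ) (w v w' v' T : ℝ → ℝ) (hw : ∀ x, a < x → HasDerivAt w (w' x) x)
    (hv : ∀ x, a < x → HasDerivAt v (v' x) x) (hP : ∀ x, a < x → 0 < w x ^ 2 + v x ^ 2)
    (hTc : ContinuousOn T (Set.Ioi a))
    (hT : ∀ x, a < x → T x * (w x ^ 2 + v x ^ 2) = v x * w' x - w x * v' x)
    (x0 θ0 : ℝ) (hx0 : a < x0)
    (h0w : w x0 = √(w x0 ^ 2 + v x0 ^ 2) * Real.cos θ0)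
    (h0v : v x0 = -√(w x0 ^ 2 + v x0 ^ 2) * Real.sin θ0) :
    ∃ θ : ℝ → ℝ, θ x0 = θ0 ∧ (∀ x, a < x → HasDerivAt θ (T x) x) ∧
      (∀ x, a < x → w x = √(w x ^ 2 + v x ^ 2) * Real.cos (θ x)) ∧
      (∀ x, a < x → v x = -√(w x ^ 2 + v x ^ 2) * Real.sin (θ x)) := by
  set θ : ℝ → ℝ := fun x => θ0 + ∫ t in x0..x, T t with hθ
  have hθ0 : θ x0 = θ0 := by simp [hθ]
  have hθd : ∀ x, a < x → HasDerivAt θ (T x) x := by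
    intro x hx
    apply HasDerivAt.const_add
    apply intervalIntegral.integral_hasDerivAt_right
    · apply (hTc.mono _).intervalIntegrable
      intro t ht
      exact (lt_min hx0 hx).trans_le ht.1
    · exact hTc.stronglyMeasurableAtFilter isOpen_Ioi x hx
    · exact hTc.continuousAt (Ioi_mem_nhds hx)
  set ρ : ℝ → ℝ := fun x => √(w x ^ 2 + v x ^ 2) with hρ
  have hρpos : ∀ x, a < x → 0 < ρ x := fun x hx => Real.sqrt_pos.2 (hP x hx)
  have hρsq : ∀ x, a < x → ρ x ^ 2 = w x ^ 2 + v x ^ 2 := fun x hx => Real.sq_sqrt (hP x hx).le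
  have hρd : ∀ x, a < x → HasDerivAt ρ ((w x * w' x + v x * v' x) / ρ x) x := by
    intro x hx
    refine ((((hw x hx).fun_pow 2).fun_add ((hv x hx).fun_pow 2)).sqrt (hP x hx).ne').congr_deriv ?_
    have := hρpos x hx
    simp only [hρ] at this ⊢
    field_simp
    simp; ring
  have hAd : ∀ x, a < x → HasDerivAt (fun x => (w x * Real.cos (θ x) - v x * Real.sin (θ x)) / ρ x) 0 x := by
    intro x hx
    have hc := (hθd x hx).cos
    have hs := (hθd x hx).sin
    refine ((((hw x hx).fun_mul hc).fun_sub ((hv x hx).fun_mul hs)).fun_div (hρd x hx) (hρpos x hx).ne').congr_deriv ?_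
    have hp := hρpos x hx
    have hsq := hρsq x hx
    have hTx := hT x hx
    rw [← hsq] at hTx
    have hTx' : T x = (v x * w' x - w x * v' x) / ρ x ^ 2 := by field_simp; linarith
    rw [hTx', div_eq_zero_iff]; left
    field_simp
    rw [show ρ x ^ 2 = w x ^ 2 + v x ^ 2 from hsq]
    ring
  have hBd : ∀ x, a < x → HasDerivAt (fun x => (w x * Real.sin (θ x) + v x * Real.cos (θ x)) / ρ x) 0 x := by
    intro x hx
    have hc := (hθd x hx).cos
    have hs := (hθd x hx).sin
    refine ((((hw x hx).fun_mul hs).fun_add ((hv x hx).fun_mul hc)).fun_div (hρd x hx) (hρpos x hx).ne').congr_deriv ?_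
    have hp := hρpos x hx
    have hsq := hρsq x hx
    have hTx := hT x hx
    rw [← hsq] at hTx
    have hTx' : T x = (v x * w' x - w x * v' x) / ρ x ^ 2 := by field_simp; linarith
    rw [hTx', div_eq_zero_iff]; left
    field_simp
    rw [show ρ x ^ 2 = w x ^ 2 + v x ^ 2 from hsq]
    ring
  have hconst : ∀ f : ℝ → ℝ, (∀ x, a < x → HasDerivAt f 0 x) → ∀ x, a < x → f x = f x0 := by
    intro f hf x hx
    apply isOpen_Ioi.is_const_of_deriv_eq_zero isPreconnected_Ioi _ _ hx hx0
    · intro t ht; exact (hf t ht).differentiableAt.differentiableWithinAt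
    · intro t ht; exact (hf t ht).deriv
  have hA : ∀ x, a < x → w x * Real.cos (θ x) - v x * Real.sin (θ x) = ρ x := by
    intro x hx
    have h := hconst _ hAd x hx
    simp only [hθ0] at h
    have h1 : w x0 * Real.cos θ0 - v x0 * Real.sin θ0 = ρ x0 := by
      have := Real.sin_sq_add_cos_sq θ0
      simp only [hρ]
      linear_combination √(w x0 ^ 2 + v x0 ^ 2) * this + Real.cos θ0 * h0w - Real.sin θ0 * h0v
    rw [h1, div_self (hρpos x0 hx0).ne', div_eq_one_iff_eq (hρpos x hx).ne'] at h
    exact h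
  have hB : ∀ x, a < x → w x * Real.sin (θ x) + v x * Real.cos (θ x) = 0 := by
    intro x hx
    have h := hconst _ hBd x hx
    simp only [hθ0] at h
    have h1 : w x0 * Real.sin θ0 + v x0 * Real.cos θ0 = 0 := by
      linear_combination Real.sin θ0 * h0w + Real.cos θ0 * h0v
    rw [h1, zero_div, div_eq_zero_iff] at h
    exact h.resolve_right (hρpos x hx).ne'
  refine ⟨θ, hθ0, hθd, fun x hx => ?_, fun x hx => ?_⟩
  · have h1 := hA x hx
    have h2 := hB x hx
    have := Real.sin_sq_add_cos_sq (θ x)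
    change w x = ρ x * _
    linear_combination -w x * this + Real.cos (θ x) * h1 + Real.sin (θ x) * h2
  · have h1 := hA x hx
    have h2 := hB x hx
    have := Real.sin_sq_add_cos_sq (θ x)
    change v x = -ρ x * _
    linear_combination -v x * this - Real.sin (θ x) * h1 + Real.cos (θ x) * h2

noncomputable def qf (ν x : ℝ) : ℝ := √(x ^ 2 - ν ^ 2)
noncomputable def psif (ν x : ℝ) : ℝ := qf ν x - ν * Real.arccos (ν / x)
noncomputable def Ef (ν x : ℝ) : ℝ := 1 / (4 * qf ν x) + 5 * ν ^ 2 / (12 * qf ν x ^ 3)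
noncomputable def rf (ν x : ℝ) : ℝ := x ^ 2 * (x ^ 2 + 4 * ν ^ 2) / (4 * qf ν x ^ 6)
noncomputable def sf (ν x : ℝ) : ℝ := √(qf ν x)

section
variable {ν x : ℝ}
lemma qf_pos (hν : 0 < ν) (hx : ν < x) : 0 < qf ν x := Real.sqrt_pos.2 (by nlinarith)
lemma qf_sq (hν : 0 < ν) (hx : ν ≤ x) : qf ν x ^ 2 = x ^ 2 - ν ^ 2 := Real.sq_sqrt (by nlinarith)
lemma sf_pos (hν : 0 < ν) (hx : ν < x) : 0 < sf ν x := Real.sqrt_pos.2 (qf_pos hν hx)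
lemma sf_sq (hν : 0 < ν) (hx : ν < x) : sf ν x ^ 2 = qf ν x := Real.sq_sqrt (qf_pos hν hx).le

lemma qf_hd (hν : 0 < ν) (hx : ν < x) : HasDerivAt (qf ν) (x / qf ν x) x := by
  have h : HasDerivAt (fun x : ℝ => x ^ 2 - ν ^ 2) (2 * x) x := by
    simpa using ((hasDerivAt_id x).fun_pow 2).sub_const (ν ^ 2)
  have hp : 0 < x ^ 2 - ν ^ 2 := by nlinarith
  refine (h.sqrt hp.ne').congr_deriv ?_
  have := qf_pos hν hx
  unfold qf at this ⊢
  field_simp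

lemma sf_hd (hν : 0 < ν) (hx : ν < x) : HasDerivAt (sf ν) (x / (2 * sf ν x ^ 3)) x := by
  refine ((qf_hd hν hx).sqrt (qf_pos hν hx).ne').congr_deriv ?_
  have := sf_pos hν hx
  change x / qf ν x / (2 * sf ν x) = _
  rw [← sf_sq hν hx]
  field_simp

lemma psif_hd (hν : 0 < ν) (hx : ν < x) : HasDerivAt (psif ν) (qf ν x / x) x := by
  have hx0 : 0 < x := hν.trans hx
  have hq := qf_pos hν hx
  have hqs := qf_sq hν hx.le
  have h1 : HasDerivAt (fun x : ℝ => ν / x) (-(ν / x ^ 2)) x := by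
    refine ((hasDerivAt_const x ν).fun_div (hasDerivAt_id x) hx0.ne').congr_deriv ?_
    simp; ring
  have hlt : ν / x < 1 := by rw [div_lt_one hx0]; exact hx
  have hgt : 0 < ν / x := by positivity
  have h2 := (Real.hasDerivAt_arccos (by linarith : ν / x ≠ -1) hlt.ne).comp x h1
  refine ((qf_hd hν hx).fun_sub (h2.const_mul ν)).congr_deriv ?_
  have e : √(1 - (ν / x) ^ 2) = qf ν x / x := by
    rw [show 1 - (ν / x) ^ 2 = (qf ν x / x) ^ 2 by rw [div_pow, div_pow, hqs]; field_simp]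
    exact Real.sqrt_sq (by positivity)
  rw [e]
  field_simp
  linarith

lemma Ef_hd (hν : 0 < ν) (hx : ν < x) : HasDerivAt (Ef ν) (-(qf ν x / x * rf ν x)) x := by
  have hx0 : 0 < x := hν.trans hx
  have hq := qf_pos hν hx
  have hqs := qf_sq hν hx.le
  have hd := qf_hd hν hx
  have h1 := ((hasDerivAt_const x (1:ℝ)).fun_div (hd.const_mul 4) (by positivity)).fun_add
    ((hasDerivAt_const x (5 * ν ^ 2)).fun_div ((hd.fun_pow 3).const_mul 12) (by positivity))
  refine h1.congr_deriv ?_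
  unfold rf
  have : x ^ 2 = qf ν x ^ 2 + ν ^ 2 := by linarith
  simp only [Nat.cast_ofNat]
  field_simp
  rw [show x ^ 2 = qf ν x ^ 2 + ν ^ 2 from this]
  ring

end


lemma bs_pos {ν : ℝ} {y z : ℝ → ℝ} (h : BSys ν y z) (p : ℝ) (hp : 0 < p) (hp3 : p ^ 3 = ν ^ 2) :
    ∀ x, ν ≤ x → x ^ 2 ≤ ν ^ 2 + p ^ 2 → 0 < y x := by
  intro X hX hX2
  by_contra hneg
  push Not at hneg
  have hν := h.hν
  have hν0 : 0 < ν := by linarith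
  have hcont : ContinuousOn y (Set.Icc ν X) := fun t ht =>
    (h.hy t (by linarith [ht.1])).continuousAt.continuousWithinAt
  have hcpt : IsCompact (Set.Icc ν X ∩ y ⁻¹' Set.Iic 0) :=
    isCompact_Icc.of_isClosed_subset (hcont.preimage_isClosed_of_isClosed isClosed_Icc isClosed_Iic)
      Set.inter_subset_left
  obtain ⟨u, ⟨hu1, hu2⟩, hu3⟩ := hcpt.exists_isLeast ⟨X, ⟨hX, le_rfl⟩, hneg⟩
  have hyu : y u ≤ 0 := hu2
  have hpos : ∀ t, ν ≤ t → t < u → 0 < y t := by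
    intro t h1 h2
    by_contra hc
    push Not at hc
    have := hu3 ⟨⟨h1, by linarith [hu1.2]⟩, hc⟩
    linarith
  set τ : ℝ → ℝ := fun x => Real.log (x / ν) with hτ
  set C : ℝ → ℝ := fun x => 1 - p ^ 2 * τ x ^ 2 / 2 with hC
  have hτd : ∀ x, 0 < x → HasDerivAt τ (1 / x) x := by
    intro x hx
    refine (((hasDerivAt_id x).div_const ν).log (by simp; exact ⟨hx.ne', hν0.ne'⟩)).congr_deriv ?_
    simp; field_simp
  have hCd : ∀ x, 0 < x → HasDerivAt C (-(p ^ 2 * τ x / x)) x := by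
    intro x hx
    refine ((((hτd x hx).fun_pow 2).const_mul (p ^ 2)).div_const 2 |>.const_sub 1).congr_deriv ?_
    simp; ring
  have hτ0 : ∀ x, ν ≤ x → 0 ≤ τ x := fun x hx => Real.log_nonneg (by rw [le_div_iff₀ hν0]; linarith)
  have hCle : ∀ x, C x ≤ 1 := fun x => by simp only [hC]; nlinarith [sq_nonneg (p * τ x)]
  have hCpos : ∀ x, ν ≤ x → x ≤ u → 0 < C x := by
    intro x h1 h2
    have hx2 : x ^ 2 ≤ ν ^ 2 + p ^ 2 := by nlinarith [hu1.2]
    have hx0 : 0 < x := by linarith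
    have h3 : 2 * τ x = Real.log ((x / ν) ^ 2) := by rw [Real.log_pow]; simp [hτ]
    have h4 : Real.log ((x / ν) ^ 2) ≤ (x / ν) ^ 2 - 1 := Real.log_le_sub_one_of_pos (by positivity)
    have h5 : (x / ν) ^ 2 - 1 ≤ p ^ 2 / ν ^ 2 := by
      rw [div_pow, div_sub_one (by positivity)]
      gcongr; linarith
    have h6 : τ x ≤ p ^ 2 / (2 * ν ^ 2) := by
      have : p ^ 2 / (2 * ν ^ 2) = (p ^ 2 / ν ^ 2) / 2 := by field_simp
      rw [this]; linarith
    have h7 : τ x ^ 2 ≤ (p ^ 2 / (2 * ν ^ 2)) ^ 2 := pow_le_pow_left₀ (hτ0 x h1) h6 2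
    have h8 : p ^ 2 * (p ^ 2 / (2 * ν ^ 2)) ^ 2 = 1 / 4 := by
      rw [← hp3]; field_simp; norm_num
    have h9 : p ^ 2 * τ x ^ 2 ≤ 1 / 4 := by rw [← h8]; gcongr
    simp only [hC]; linarith
  set W : ℝ → ℝ := fun x => z x * C x + p ^ 2 * τ x * y x with hW
  have hWd : ∀ x, 0 < x → HasDerivAt W (y x / x * (p ^ 2 - (x ^ 2 - ν ^ 2) * C x)) x := by
    intro x hx
    refine (((h.hz x hx).fun_mul (hCd x hx)).fun_add
      (((hτd x hx).const_mul (p ^ 2)).fun_mul (h.hy x hx))).congr_deriv ?_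
    field_simp; ring
  have hWm : MonotoneOn W (Set.Icc ν u) := by
    apply monotoneOn_of_deriv_nonneg (convex_Icc _ _)
    · intro x hx; exact (hWd x (by linarith [hx.1])).continuousAt.continuousWithinAt
    · intro x hx; rw [interior_Icc] at hx
      exact (hWd x (by linarith [hx.1])).differentiableAt.differentiableWithinAt
    · intro x hx; rw [interior_Icc] at hx
      have hx0 : 0 < x := by linarith [hx.1]
      rw [(hWd x hx0).deriv]
      apply mul_nonneg (div_nonneg (hpos x hx.1.le hx.2).le hx0.le)
      have hx2 : x ^ 2 ≤ ν ^ 2 + p ^ 2 := by nlinarith [hu1.2, hx.2]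
      have hx3 : ν ^ 2 ≤ x ^ 2 := by nlinarith [hx.1]
      have := mul_le_mul_of_nonneg_left (hCle x) (by linarith : 0 ≤ x ^ 2 - ν ^ 2)
      linarith
  have hτν : τ ν = 0 := by simp [hτ, hν0.ne']
  have hCν : C ν = 1 := by simp [hC, hτν]
  have hWν : W ν = z ν := by simp [hW, hτν, hCν]
  have hW0 : ∀ x ∈ Set.Icc ν u, 0 ≤ W x := by
    intro x hx
    have := hWm (Set.left_mem_Icc.2 hu1.1) hx hx.1
    linarith [h.hzν]
  have hYm : MonotoneOn (fun x => y x / C x) (Set.Icc ν u) := by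
    have hd : ∀ x ∈ Set.Icc ν u, HasDerivAt (fun x => y x / C x) (W x / (x * C x ^ 2)) x := by
      intro x hx
      have hx0 : 0 < x := by linarith [hx.1]
      have hc := hCpos x hx.1 hx.2
      refine ((h.hy x hx0).fun_div (hCd x hx0) hc.ne').congr_deriv ?_
      simp only [hW]
      field_simp; ring
    apply monotoneOn_of_deriv_nonneg (convex_Icc _ _)
    · intro x hx; exact (hd x hx).continuousAt.continuousWithinAt
    · intro x hx
      exact (hd x (interior_subset hx)).differentiableAt.differentiableWithinAt
    · intro x hx
      have hx := interior_subset hx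
      have hx0 : 0 < x := by linarith [hx.1]
      rw [(hd x hx).deriv]
      have := hW0 x hx
      positivity
  have := hYm (Set.left_mem_Icc.2 hu1.1) (Set.right_mem_Icc.2 hu1.1) hu1.1
  simp only [hCν, div_one] at this
  have h1 := h.hyν
  have h2 : y u / C u ≤ 0 := div_nonpos_of_nonpos_of_nonneg hyu (hCpos u hu1.1 le_rfl).le
  linarith

noncomputable def wf (ν : ℝ) (y : ℝ → ℝ) (x : ℝ) : ℝ := sf ν x * y x
noncomputable def vf (ν : ℝ) (y z : ℝ → ℝ) (x : ℝ) : ℝ := z x / sf ν x + x ^ 2 * y x / (2 * sf ν x ^ 5)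

section
variable {ν : ℝ} {y z : ℝ → ℝ}

lemma wf_hd (h : BSys ν y z) {x : ℝ} (hx : ν < x) : HasDerivAt (wf ν y) (qf ν x / x * vf ν y z x) x := by
  have hν0 : 0 < ν := by linarith [h.hν]
  have hx0 : 0 < x := hν0.trans hx
  have hs := sf_pos hν0 hx
  refine ((sf_hd hν0 hx).fun_mul (h.hy x hx0)).congr_deriv ?_
  unfold vf
  rw [← sf_sq hν0 hx]
  field_simp; ring

lemma vf_hd (h : BSys ν y z) {x : ℝ} (hx : ν < x) :
    HasDerivAt (vf ν y z) (-(qf ν x / x * (1 + rf ν x) * wf ν y x)) x := by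
  have hν0 : 0 < ν := by linarith [h.hν]
  have hx0 : 0 < x := hν0.trans hx
  have hs := sf_pos hν0 hx
  have hs4 : sf ν x ^ 4 = x ^ 2 - ν ^ 2 := by
    rw [← qf_sq hν0 hx.le, ← sf_sq hν0 hx]; ring
  have hd := sf_hd hν0 hx
  refine (((h.hz x hx0).fun_div hd hs.ne').fun_add
    ((((hasDerivAt_id x).fun_pow 2).fun_mul (h.hy x hx0)).fun_div
      ((hd.fun_pow 5).const_mul 2) (by positivity))).congr_deriv ?_
  unfold wf rf
  rw [← sf_sq hν0 hx]
  have hν2 : ν ^ 2 = x ^ 2 - sf ν x ^ 4 := by linarith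
  rw [hν2]
  simp only [id, Nat.cast_ofNat]
  field_simp
  ring

lemma wv_pos (h : BSys ν y z) {x : ℝ} (hx : ν < x) : 0 < wf ν y x ^ 2 + vf ν y z x ^ 2 := by
  have hν0 : 0 < ν := by linarith [h.hν]
  have hx0 : 0 < x := hν0.trans hx
  have hs := sf_pos hν0 hx
  by_contra hc
  push Not at hc
  have hw : wf ν y x = 0 := by nlinarith [sq_nonneg (wf ν y x), sq_nonneg (vf ν y z x)]
  have hv : vf ν y z x = 0 := by nlinarith [sq_nonneg (wf ν y x), sq_nonneg (vf ν y z x)]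
  have hy : y x = 0 := by
    unfold wf at hw; exact (mul_eq_zero.1 hw).resolve_left hs.ne'
  have hz : z x = 0 := by
    unfold vf at hv; rw [hy] at hv
    simp at hv
    exact hv.resolve_right hs.ne'
  exact h.hnt x hx0 hy hz
end


section
variable {ν : ℝ} {y z : ℝ → ℝ}

lemma rf_pos {x : ℝ} (hν : 0 < ν) (hx : ν < x) : 0 < rf ν x := by
  have := qf_pos hν hx
  have hx0 : 0 < x := hν.trans hx
  unfold rf; positivity

lemma rf_cont (hν : 0 < ν) : ContinuousOn (rf ν) (Set.Ioi ν) := by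
  have hq : ContinuousOn (qf ν) (Set.Ioi ν) := fun x hx => (qf_hd hν hx).continuousAt.continuousWithinAt
  unfold rf
  apply ContinuousOn.div
  · fun_prop
  · fun_prop
  · intro x hx
    have := qf_pos hν hx
    positivity

lemma mono_of_hd {f f' : ℝ → ℝ} {a : ℝ} (hd : ∀ x, a < x → HasDerivAt f (f' x) x)
    (hn : ∀ x, a < x → 0 ≤ f' x) : MonotoneOn f (Set.Ioi a) := by
  apply monotoneOn_of_deriv_nonneg (convex_Ioi a)
  · intro x hx; exact (hd x hx).continuousAt.continuousWithinAt
  · intro x hx; exact (hd x (interior_subset hx)).differentiableAt.differentiableWithinAt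
  · intro x hx; rw [(hd x (interior_subset hx)).deriv]; exact hn x (interior_subset hx)

lemma strictMono_of_hd {f f' : ℝ → ℝ} {a : ℝ} (hd : ∀ x, a < x → HasDerivAt f (f' x) x)
    (hn : ∀ x, a < x → 0 < f' x) : StrictMonoOn f (Set.Ioi a) := by
  apply strictMonoOn_of_deriv_pos (convex_Ioi a)
  · intro x hx; exact (hd x hx).continuousAt.continuousWithinAt
  · intro x hx; rw [(hd x (interior_subset hx)).deriv]; exact hn x (interior_subset hx)

lemma phase1 (h : BSys ν y z) (p : ℝ) (hp : 0 < p) (hp3 : p ^ 3 = ν ^ 2) :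
    ∃ θ : ℝ → ℝ, (∀ x, ν < x → HasDerivAt θ (qf ν x / x * (1 + rf ν x * Real.cos (θ x) ^ 2)) x) ∧
      (∀ x, ν < x → wf ν y x = √(wf ν y x ^ 2 + vf ν y z x ^ 2) * Real.cos (θ x)) ∧
      (∀ x, ν < x → vf ν y z x = -√(wf ν y x ^ 2 + vf ν y z x ^ 2) * Real.sin (θ x)) ∧
      (∀ x, ν < x → -(π / 2) < θ x) ∧ θ (√(ν ^ 2 + p ^ 2)) < π / 2 := by
  have hν0 : 0 < ν := by linarith [h.hν]
  set x1 := √(ν ^ 2 + p ^ 2) with hx1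
  have hx1s : x1 ^ 2 = ν ^ 2 + p ^ 2 := Real.sq_sqrt (by positivity)
  have hx1p : 0 ≤ x1 := Real.sqrt_nonneg _
  have hνx1 : ν < x1 := by
    apply lt_of_pow_lt_pow_left₀ 2 hx1p; nlinarith
  have hwc : ContinuousOn (wf ν y) (Set.Ioi ν) := fun x hx => (wf_hd h hx).continuousAt.continuousWithinAt
  have hvc : ContinuousOn (vf ν y z) (Set.Ioi ν) := fun x hx => (vf_hd h hx).continuousAt.continuousWithinAt
  have hqc : ContinuousOn (qf ν) (Set.Ioi ν) := fun x hx => (qf_hd hν0 hx).continuousAt.continuousWithinAt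
  have hrc := rf_cont hν0
  have hw1 : 0 < wf ν y x1 := mul_pos (sf_pos hν0 hνx1) (bs_pos h p hp hp3 x1 hνx1.le hx1s.le)
  set w1 := wf ν y x1 with hw1d
  set v1 := vf ν y z x1 with hv1d
  have hs : √(w1 ^ 2 + v1 ^ 2) = w1 * √(1 + (-v1 / w1) ^ 2) := by
    rw [← Real.sqrt_sq hw1.le, ← Real.sqrt_mul (sq_nonneg _), Real.sqrt_sq hw1.le]
    congr 1; field_simp
  have hsp : 0 < √(1 + (-v1 / w1) ^ 2) := Real.sqrt_pos.2 (by positivity)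
  obtain ⟨θ, hθ0, hθd, hθw, hθv⟩ := lift_angle ν (wf ν y) (vf ν y z)
    (fun x => qf ν x / x * vf ν y z x) (fun x => -(qf ν x / x * (1 + rf ν x) * wf ν y x))
    (fun x => qf ν x / x * (1 + rf ν x * (wf ν y x ^ 2 / (wf ν y x ^ 2 + vf ν y z x ^ 2))))
    (fun x hx => wf_hd h hx) (fun x hx => vf_hd h hx) (fun x hx => wv_pos h hx)
    (by
      refine (hqc.div continuousOn_id (fun x hx => (hν0.trans hx).ne')).mul
        (continuousOn_const.add (hrc.mul ((hwc.pow 2).div ((hwc.pow 2).add (hvc.pow 2)) ?_)))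
      intro x hx; exact (wv_pos h hx).ne')
    (by
      intro x hx
      have := wv_pos h hx
      have hx0 := hν0.trans hx
      field_simp
      ring)
    x1 (Real.arctan (-v1 / w1)) hνx1
    (by rw [← hw1d, ← hv1d, hs, Real.cos_arctan]; field_simp)
    (by rw [← hw1d, ← hv1d, hs, Real.sin_arctan]; field_simp)
  have hθd' : ∀ x, ν < x → HasDerivAt θ (qf ν x / x * (1 + rf ν x * Real.cos (θ x) ^ 2)) x := by
    intro x hx
    refine (hθd x hx).congr_deriv ?_
    have hp := wv_pos h hx
    have : wf ν y x ^ 2 / (wf ν y x ^ 2 + vf ν y z x ^ 2) = Real.cos (θ x) ^ 2 := by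
      rw [div_eq_iff hp.ne']
      calc wf ν y x ^ 2 = (√(wf ν y x ^ 2 + vf ν y z x ^ 2) * Real.cos (θ x)) ^ 2 := by
            rw [← hθw x hx]
        _ = _ := by rw [mul_pow, Real.sq_sqrt hp.le]; ring
    rw [this]
  have hmono : StrictMonoOn θ (Set.Ioi ν) := by
    apply strictMono_of_hd hθd'
    intro x hx
    have := qf_pos hν0 hx
    have := rf_pos hν0 hx
    have := hν0.trans hx
    positivity
  have hlow1 : -(π / 2) < θ x1 := by rw [hθ0]; exact Real.neg_pi_div_two_lt_arctan _
  refine ⟨θ, hθd', hθw, hθv, ?_, ?_⟩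
  · intro x hx
    rcases le_or_gt x1 x with h1 | h1
    · exact hlow1.trans_le (hmono.monotoneOn hνx1 hx h1)
    · by_contra hc
      push Not at hc
      have hcont : ContinuousOn θ (Set.Icc x x1) := fun t ht =>
        (hθd t (by linarith [ht.1])).continuousAt.continuousWithinAt
      obtain ⟨t, ht, hte⟩ := intermediate_value_Icc h1.le hcont ⟨hc, hlow1.le⟩
      have htν : ν < t := by linarith [ht.1]
      have h2 := hθw t htν
      rw [hte, Real.cos_neg, Real.cos_pi_div_two, mul_zero] at h2
      have h3 := mul_pos (sf_pos hν0 htν) (bs_pos h p hp hp3 t htν.le (by nlinarith [ht.2]))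
      unfold wf at h2
      linarith
  · rw [hθ0]; exact Real.arctan_lt_pi_div_two _
end

section
open Filter Topology

section
variable {ν : ℝ} {y z : ℝ → ℝ}

lemma psif_self (hν : 0 < ν) : psif ν ν = 0 := by simp [psif, qf, hν.ne']

lemma psif_cont (hν : 0 < ν) : ContinuousOn (psif ν) (Set.Ici ν) := by
  unfold psif qf
  apply ContinuousOn.sub
  · fun_prop
  · apply continuousOn_const.mul
    apply Real.continuous_arccos.comp_continuousOn
    exact continuousOn_const.div continuousOn_id (fun x hx => (hν.trans_le hx).ne')

lemma psif_smono (hν : 0 < ν) : StrictMonoOn (psif ν) (Set.Ici ν) := by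
  apply strictMonoOn_of_deriv_pos (convex_Ici ν) (psif_cont hν)
  intro x hx
  rw [interior_Ici] at hx
  rw [(psif_hd hν hx).deriv]
  exact div_pos (qf_pos hν hx) (hν.trans hx)

lemma psif_pos {x : ℝ} (hν : 0 < ν) (hx : ν < x) : 0 < psif ν x := by
  have := psif_smono hν (Set.self_mem_Ici) (Set.mem_Ici.2 hx.le) hx
  rwa [psif_self hν] at this

lemma psif_le_q {x : ℝ} (hν : 0 < ν) : psif ν x ≤ qf ν x := by
  unfold psif
  have := mul_nonneg hν.le (Real.arccos_nonneg (ν / x))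
  linarith

lemma psif_le_cube {x : ℝ} (hν : 0 < ν) (hx : ν ≤ x) : psif ν x ≤ qf ν x ^ 3 / (3 * ν ^ 2) := by
  have hd : ∀ x, ν < x → HasDerivAt (fun x => qf ν x ^ 3 / (3 * ν ^ 2) - psif ν x)
      (qf ν x * x / ν ^ 2 - qf ν x / x) x := by
    intro x hx
    have := qf_pos hν hx
    refine ((((qf_hd hν hx).fun_pow 3).div_const (3 * ν ^ 2)).fun_sub (psif_hd hν hx)).congr_deriv ?_
    simp; field_simp
  have hm : MonotoneOn (fun x => qf ν x ^ 3 / (3 * ν ^ 2) - psif ν x) (Set.Ici ν) := by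
    apply monotoneOn_of_deriv_nonneg (convex_Ici ν)
    · apply ContinuousOn.sub _ (psif_cont hν)
      unfold qf; fun_prop
    · intro x hx; rw [interior_Ici] at hx
      exact (hd x hx).differentiableAt.differentiableWithinAt
    · intro x hx; rw [interior_Ici] at hx
      have hx' : ν < x := hx
      rw [(hd x hx).deriv]
      have hq := qf_pos hν hx
      have hx0 := hν.trans hx
      have : qf ν x * x / ν ^ 2 - qf ν x / x = qf ν x * (x ^ 2 - ν ^ 2) / (ν ^ 2 * x) := by
        field_simp
      rw [this]
      have : 0 ≤ x ^ 2 - ν ^ 2 := by nlinarith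
      positivity
  have := hm Set.self_mem_Ici (Set.mem_Ici.2 hx) hx
  simp only [psif_self hν] at this
  have h2 : qf ν ν = 0 := by simp [qf]
  rw [h2] at this
  norm_num at this
  linarith

lemma Ef_pos {x : ℝ} (hν : 0 < ν) (hx : ν < x) : 0 < Ef ν x := by
  have := qf_pos hν hx
  unfold Ef; positivity

lemma Ef_le {x : ℝ} (hν : 0 < ν) (hx : ν < x) : Ef ν x ≤ 7 / (18 * psif ν x) := by
  have hq := qf_pos hν hx
  have hp := psif_pos hν hx
  have h1 := psif_le_q (x := x) hν
  have h2 := psif_le_cube hν hx.le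
  have h3 : 1 / (4 * qf ν x) ≤ 1 / (4 * psif ν x) := by gcongr
  have h4 : 5 * ν ^ 2 / (12 * qf ν x ^ 3) ≤ 5 / (36 * psif ν x) := by
    rw [le_div_iff₀ (by positivity)] at h2
    rw [div_le_div_iff₀ (by positivity) (by positivity)]
    nlinarith
  have h5 : 7 / (18 * psif ν x) = 1 / (4 * psif ν x) + 5 / (36 * psif ν x) := by field_simp; norm_num
  unfold Ef; linarith

lemma qf_tendsto (ν : ℝ) (hν : 0 < ν) : Tendsto (fun x => qf ν x - x) atTop (𝓝 0) := by
  have h1 : Tendsto (fun x : ℝ => -(ν ^ 2 / x)) atTop (𝓝 0) := by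
    have := (tendsto_const_nhds (x := ν ^ 2)).div_atTop (tendsto_id (α := ℝ) (x := atTop))
    simpa using this.neg
  refine tendsto_of_tendsto_of_tendsto_of_le_of_le' h1 tendsto_const_nhds ?_ ?_
  · filter_upwards [eventually_gt_atTop ν] with x hx
    have hx0 := hν.trans hx
    have hq := qf_pos hν hx
    have hs := qf_sq hν hx.le
    have : x - ν ^ 2 / x ≤ qf ν x := by
      apply Real.le_sqrt_of_sq_le
      have h0 : ν ^ 2 / x * x = ν ^ 2 := by field_simp
      have h2 : 0 ≤ ν ^ 2 / x := by positivity
      have h3 : ν ^ 2 / x ≤ x := by rw [div_le_iff₀ hx0]; nlinarith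
      nlinarith
    linarith
  · filter_upwards [eventually_gt_atTop ν] with x hx
    have hx0 := hν.trans hx
    have : qf ν x ≤ x := by
      unfold qf; rw [Real.sqrt_le_left hx0.le]; nlinarith
    linarith

lemma psif_tendsto (hν : 0 < ν) : Tendsto (fun x => psif ν x - x) atTop (𝓝 (-(ν * (π / 2)))) := by
  have h1 := qf_tendsto ν hν
  have h2 : Tendsto (fun x : ℝ => ν / x) atTop (𝓝 0) :=
    (tendsto_const_nhds (x := ν)).div_atTop (tendsto_id (α := ℝ) (x := atTop))
  have h3 := ((Real.continuous_arccos.tendsto 0).comp h2).const_mul ν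
  have h4 := h1.sub h3
  rw [Real.arccos_zero, zero_sub] at h4
  refine h4.congr (fun x => ?_)
  simp [psif]; ring

lemma Ef_tendsto (hν : 0 < ν) : Tendsto (Ef ν) atTop (𝓝 0) := by
  have hq : Tendsto (qf ν) atTop atTop := by
    have := (qf_tendsto ν hν).add_atTop (tendsto_id (α := ℝ) (x := atTop))
    refine this.congr (fun x => by simp)
  have h1 := (tendsto_const_nhds (x := (1:ℝ))).div_atTop (hq.const_mul_atTop (by norm_num : (0:ℝ) < 4))
  have h2 := (tendsto_const_nhds (x := 5 * ν ^ 2)).div_atTop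
    (((tendsto_pow_atTop (by norm_num : (3:ℕ) ≠ 0)).comp hq).const_mul_atTop (by norm_num : (0:ℝ) < 12))
  have h3 := h1.add h2
  rw [add_zero] at h3
  exact h3

lemma wv_low (h : BSys ν y z) {x1 : ℝ} (hx1 : ν < x1) :
    ∃ c, 0 < c ∧ ∀ x, x1 ≤ x → c ≤ wf ν y x ^ 2 + vf ν y z x ^ 2 := by
  have hν : 0 < ν := by linarith [h.hν]
  have hd : ∀ x, ν < x → HasDerivAt (fun x => (wf ν y x ^ 2 + vf ν y z x ^ 2) * Real.exp (-Ef ν x))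
      (qf ν x / x * rf ν x * (wf ν y x - vf ν y z x) ^ 2 * Real.exp (-Ef ν x)) x := by
    intro x hx
    refine ((((wf_hd h hx).fun_pow 2).fun_add ((vf_hd h hx).fun_pow 2)).fun_mul
      (Ef_hd hν hx).fun_neg.exp).congr_deriv ?_
    simp; ring
  have hm := mono_of_hd hd (by
    intro x hx
    have := qf_pos hν hx
    have := rf_pos hν hx
    have := hν.trans hx
    positivity)
  refine ⟨(wf ν y x1 ^ 2 + vf ν y z x1 ^ 2) * Real.exp (-Ef ν x1), mul_pos (wv_pos h hx1) (Real.exp_pos _), ?_⟩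
  intro x hx
  have hx' : ν < x := hx1.trans_le hx
  have h1 := hm hx1 hx' hx
  simp only at h1
  refine h1.trans ?_
  have h2 : Real.exp (-Ef ν x) ≤ 1 := Real.exp_le_one_iff.2 (by linarith [Ef_pos hν hx'])
  have := mul_le_mul_of_nonneg_left h2 (wv_pos h hx').le
  linarith
end
end

section
open Filter Topology

section
variable {ν : ℝ} {y z : ℝ → ℝ}

lemma phase2 (h : BSys ν y z) :
    ∃ θ : ℝ → ℝ, (∀ x, ν < x → HasDerivAt θ (qf ν x / x * (1 + rf ν x * Real.cos (θ x) ^ 2)) x) ∧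
      (∀ x, ν < x → wf ν y x = √(wf ν y x ^ 2 + vf ν y z x ^ 2) * Real.cos (θ x)) ∧
      (∀ x, ν < x → vf ν y z x = -√(wf ν y x ^ 2 + vf ν y z x ^ 2) * Real.sin (θ x)) ∧
      (∀ x, ν < x → -(π / 2) < θ x) ∧
      (∀ x, ν < x → θ x ≤ psif ν x - π / 4) ∧ (∀ x, ν < x → psif ν x - π / 4 - Ef ν x ≤ θ x) := by
  have hν1 := h.hν
  have hν : 0 < ν := by linarith [h.hν]
  obtain ⟨p, hp1, hp3⟩ : ∃ p : ℝ, 1 ≤ p ∧ p ^ 3 = ν ^ 2 := by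
    refine ⟨ν ^ ((2:ℝ) / 3), Real.one_le_rpow hν1 (by norm_num), ?_⟩
    rw [← Real.rpow_natCast, ← Real.rpow_mul hν.le, ← Real.rpow_natCast ν 2]; norm_num
  have hp : 0 < p := by linarith
  obtain ⟨θ, hd, hw, hv, hlow, hup⟩ := phase1 h p hp hp3
  set x1 := √(ν ^ 2 + p ^ 2) with hx1
  have hx1s : x1 ^ 2 = ν ^ 2 + p ^ 2 := Real.sq_sqrt (by positivity)
  have hx1p : 0 ≤ x1 := Real.sqrt_nonneg _
  have hνx1 : ν < x1 := by
    apply lt_of_pow_lt_pow_left₀ 2 hx1p; nlinarith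
  have hq1 : qf ν x1 = p := by
    unfold qf; rw [hx1s, show ν ^ 2 + p ^ 2 - ν ^ 2 = p ^ 2 by ring, Real.sqrt_sq hp.le]
  set F : ℝ → ℝ := fun x => θ x - psif ν x with hF
  set G : ℝ → ℝ := fun x => -(θ x - psif ν x + Ef ν x) with hG
  have hqx : ∀ x, ν < x → 0 < qf ν x / x * rf ν x := fun x hx =>
    mul_pos (div_pos (qf_pos hν hx) (hν.trans hx)) (rf_pos hν hx)
  have hFm : MonotoneOn F (Set.Ioi ν) := by
    apply mono_of_hd (f' := fun x => qf ν x / x * rf ν x * Real.cos (θ x) ^ 2)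
    · intro x hx
      refine ((hd x hx).fun_sub (psif_hd hν hx)).congr_deriv ?_
      ring
    · intro x hx
      have := hqx x hx
      positivity
  have hGm : MonotoneOn G (Set.Ioi ν) := by
    apply mono_of_hd (f' := fun x => qf ν x / x * rf ν x * Real.sin (θ x) ^ 2)
    · intro x hx
      refine (((hd x hx).fun_sub (psif_hd hν hx)).fun_add (Ef_hd hν hx)).fun_neg.congr_deriv ?_
      rw [Real.sin_sq]; ring
    · intro x hx
      have := hqx x hx
      positivity
  have hFG : ∀ x t, ν < x → ν < t → F x ≤ F t + Ef ν t := by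
    intro x t hx ht
    have e1 : F t + Ef ν t = - G t := by simp [hF, hG]
    have e2 : F x + Ef ν x = - G x := by simp [hF, hG]
    rcases le_total x t with hxt | hxt
    · have := hFm hx ht hxt
      linarith [Ef_pos hν ht]
    · have := hGm ht hx hxt
      linarith [Ef_pos hν hx]
  have hne : (F '' Set.Ioi ν).Nonempty := ⟨F x1, x1, hνx1, rfl⟩
  have hbd : BddAbove (F '' Set.Ioi ν) := by
    refine ⟨F x1 + Ef ν x1, ?_⟩
    rintro _ ⟨x, hx, rfl⟩
    exact hFG x x1 hx hνx1
  set L := sSup (F '' Set.Ioi ν) with hL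
  have hL1 : ∀ x, ν < x → F x ≤ L := fun x hx => le_csSup hbd ⟨x, hx, rfl⟩
  have hL2 : ∀ x, ν < x → L ≤ F x + Ef ν x := by
    intro x hx
    apply csSup_le hne
    rintro _ ⟨t, ht, rfl⟩
    exact hFG t x ht hx
  have hLlow : -(π / 2) - 1 / 3 < L := by
    have h1 := hL1 x1 hνx1
    have h2 := psif_le_cube hν hνx1.le
    rw [hq1, hp3] at h2
    have : ν ^ 2 / (3 * ν ^ 2) = 1 / 3 := by field_simp
    have h3 := hlow x1 hνx1
    simp only [hF] at h1
    linarith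
  have hLup : L < π / 2 + 2 / 3 := by
    have h1 := hL2 x1 hνx1
    have h2 : Ef ν x1 ≤ 2 / 3 := by
      unfold Ef; rw [hq1, hp3]
      have e1 : 5 * ν ^ 2 / (12 * ν ^ 2) = 5 / 12 := by field_simp
      have e2 : 1 / (4 * p) ≤ 1 / 4 := by
        apply one_div_le_one_div_of_le <;> linarith
      linarith
    have h3 := psif_pos hν hνx1
    simp only [hF] at h1
    linarith
  have hFt : Tendsto F atTop (𝓝 L) := by
    have h1 : Tendsto (fun x => L - Ef ν x) atTop (𝓝 L) := by
      simpa using (tendsto_const_nhds (x := L)).sub (Ef_tendsto hν)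
    refine tendsto_of_tendsto_of_tendsto_of_le_of_le' h1 tendsto_const_nhds ?_ ?_
    · filter_upwards [eventually_gt_atTop ν] with x hx
      linarith [hL2 x hx]
    · filter_upwards [eventually_gt_atTop ν] with x hx
      exact hL1 x hx
  -- along the sequence
  set X : ℕ → ℝ := fun m => ν * π / 2 + 3 * π / 4 + m * π with hX
  have hXt : Tendsto X atTop atTop := by
    apply tendsto_atTop_add_const_left
    exact tendsto_natCast_atTop_atTop.atTop_mul_const Real.pi_pos
  have hθt : Tendsto (fun m : ℕ => θ (X m) - m * π) atTop (𝓝 (L + 3 * π / 4)) := by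
    have h1 := (hFt.add (psif_tendsto hν)).comp hXt
    have h2 := h1.add_const (ν * π / 2 + 3 * π / 4)
    rw [show L + -(ν * (π / 2)) + (ν * π / 2 + 3 * π / 4) = L + 3 * π / 4 by ring] at h2
    refine h2.congr (fun m => ?_)
    simp only [hF, hX, Function.comp]; ring
  have hcos1 : Tendsto (fun m : ℕ => Real.cos (θ (X m) - m * π) ^ 2) atTop (𝓝 (Real.cos (L + 3 * π / 4) ^ 2)) :=
    ((Real.continuous_cos.tendsto _).comp hθt).pow 2
  obtain ⟨A, D, hAD⟩ := h.has
  obtain ⟨c, hc, hclow⟩ := wv_low h hνx1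
  have hcos2 : Tendsto (fun m : ℕ => Real.cos (θ (X m) - m * π) ^ 2) atTop (𝓝 0) := by
    have h1 : Tendsto (fun m : ℕ => (D ^ 2 / c) / X m) atTop (𝓝 0) :=
      (tendsto_const_nhds (x := D ^ 2 / c)).div_atTop hXt
    refine tendsto_of_tendsto_of_tendsto_of_le_of_le' tendsto_const_nhds h1 ?_ ?_
    · exact Eventually.of_forall fun m => sq_nonneg _
    · filter_upwards [hXt.eventually (eventually_ge_atTop x1)] with m hm
      have hmν : ν < X m := hνx1.trans_le hm
      have hm0 : 0 < X m := hν.trans hmν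
      have hcc : Real.cos (θ (X m) - m * π) ^ 2 = Real.cos (θ (X m)) ^ 2 := by
        rw [Real.cos_sub_nat_mul_pi, mul_pow, ← pow_mul, mul_comm m 2, pow_mul]; norm_num
      have h2 := hAD (X m) hm0
      have hz0 : Real.cos (X m - ν * π / 2 - π / 4) = 0 := by
        rw [show X m - ν * π / 2 - π / 4 = π / 2 + m * π by simp only [hX]; ring,
          Real.cos_add_nat_mul_pi, Real.cos_pi_div_two, mul_zero]
      rw [hz0, mul_zero, sub_zero] at h2
      have h3 : (√(X m) * y (X m)) ^ 2 ≤ (D / √(X m)) ^ 2 := sq_le_sq.2 (h2.trans (le_abs_self _))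
      rw [mul_pow, div_pow, Real.sq_sqrt hm0.le] at h3
      have hwle : wf ν y (X m) ^ 2 ≤ D ^ 2 / X m := by
        refine le_trans ?_ h3
        unfold wf
        rw [mul_pow, sf_sq hν hmν]
        have : qf ν (X m) ≤ X m := by
          unfold qf; rw [Real.sqrt_le_left hm0.le]; nlinarith
        exact mul_le_mul_of_nonneg_right this (sq_nonneg _)
      have hPp := wv_pos h hmν
      have h4 : wf ν y (X m) ^ 2 = (wf ν y (X m) ^ 2 + vf ν y z (X m) ^ 2) * Real.cos (θ (X m)) ^ 2 := by
        calc wf ν y (X m) ^ 2 = (√(wf ν y (X m) ^ 2 + vf ν y z (X m) ^ 2) * Real.cos (θ (X m))) ^ 2 := by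
              rw [← hw _ hmν]
          _ = _ := by rw [mul_pow, Real.sq_sqrt hPp.le]
      rw [hcc, div_right_comm, le_div_iff₀ hc]
      calc Real.cos (θ (X m)) ^ 2 * c ≤ Real.cos (θ (X m)) ^ 2 * (wf ν y (X m) ^ 2 + vf ν y z (X m) ^ 2) :=
            mul_le_mul_of_nonneg_left (hclow _ hm) (sq_nonneg _)
        _ = wf ν y (X m) ^ 2 := by rw [mul_comm]; exact h4.symm
        _ ≤ _ := hwle
  have hcos0 : Real.cos (L + 3 * π / 4) = 0 := by
    have := tendsto_nhds_unique hcos1 hcos2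
    exact pow_eq_zero_iff (two_ne_zero) |>.1 this
  obtain ⟨j, hj⟩ := Real.cos_eq_zero_iff.1 hcos0
  have hpi := Real.pi_gt_three
  have hLe : L = -(π / 4) := by
    have hj0 : j = 0 := by
      have hLj : L = -(π / 4) + j * π := by linarith
      have h1 : j < 1 := by
        by_contra hcon
        push Not at hcon
        have : (1:ℝ) ≤ j := by exact_mod_cast hcon
        nlinarith
      have h2 : -1 < j := by
        by_contra hcon
        push Not at hcon
        have : (j:ℝ) ≤ -1 := by exact_mod_cast hcon
        nlinarith
      omega
    rw [hj0] at hj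
    push_cast at hj
    linarith
  refine ⟨θ, hd, hw, hv, hlow, ?_, ?_⟩
  · intro x hx
    have := hL1 x hx
    simp only [hF] at this
    linarith
  · intro x hx
    have := hL2 x hx
    simp only [hF] at this
    linarith
end
end

section
open Filter Topology

section
variable {ν : ℝ} {y z : ℝ → ℝ}

noncomputable def bf (σ ν x : ℝ) : ℝ := σ / qf ν x - x ^ 2 / (2 * qf ν x ^ 3)

lemma bf_abs {σ x : ℝ} (hσ : 0 < σ) (hν : 0 < ν) (hx : ν < x) : |bf σ ν x| ≤ (σ + 2 / 3) / psif ν x := by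
  have hq := qf_pos hν hx
  have hp := psif_pos hν hx
  have h1 := psif_le_q (x := x) hν
  have h2 := psif_le_cube hν hx.le
  have h3 : σ / qf ν x ≤ σ / psif ν x := by gcongr
  have h4 : x ^ 2 / (2 * qf ν x ^ 3) ≤ (2 / 3) / psif ν x := by
    have hs := qf_sq hν hx.le
    have e : x ^ 2 / (2 * qf ν x ^ 3) = 1 / (2 * qf ν x) + ν ^ 2 / (2 * qf ν x ^ 3) := by
      rw [show x ^ 2 = qf ν x ^ 2 + ν ^ 2 by linarith]; field_simp
    have e2 : (2 / 3) / psif ν x = 1 / (2 * psif ν x) + 1 / (6 * psif ν x) := by field_simp; norm_num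
    have e3 : 1 / (2 * qf ν x) ≤ 1 / (2 * psif ν x) := by gcongr
    have e4 : ν ^ 2 / (2 * qf ν x ^ 3) ≤ 1 / (6 * psif ν x) := by
      rw [le_div_iff₀ (by positivity)] at h2
      rw [div_le_div_iff₀ (by positivity) (by positivity)]
      nlinarith
    rw [e, e2]; linarith
  have h5 : 0 < σ / qf ν x := by positivity
  have h6 : 0 ≤ x ^ 2 / (2 * qf ν x ^ 3) := by positivity
  have h7 : 0 < σ / psif ν x := by positivity
  have h8 : 0 < (2 / 3) / psif ν x := by positivity
  unfold bf
  rw [add_div, abs_le]; constructor <;> linarith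

lemma arctan_abs_le (b : ℝ) : |Real.arctan b| ≤ |b| := by
  have key : ∀ t : ℝ, 0 ≤ t → Real.arctan t ≤ t := by
    intro t ht
    rcases ht.eq_or_lt with rfl | ht
    · simp
    have h1 : 0 < Real.arctan t := Real.arctan_pos.2 ht
    have := Real.lt_tan h1 (Real.arctan_lt_pi_div_two t)
    rw [Real.tan_arctan] at this
    exact this.le
  rcases le_total 0 b with hb | hb
  · rw [abs_of_nonneg hb, abs_of_nonneg (Real.arctan_nonneg.2 hb)]; exact key b hb
  · have := key (-b) (by linarith)
    rw [Real.arctan_neg] at this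
    rw [abs_of_nonpos hb, abs_of_nonpos (by have := Real.arctan_nonneg.2 (by linarith : 0 ≤ -b); rw [Real.arctan_neg] at this; linarith)]
    exact this

lemma zero_between (h : BSys ν y z) {σ : ℝ} (hσ : 0 < σ) {s t : ℝ} (hs : ν < s) (hst : s < t)
    (h1 : z s + σ * y s = 0) (h2 : z t + σ * y t = 0) : ∃ u, s < u ∧ u < t ∧ y u = 0 := by
  have hν : 0 < ν := by linarith [h.hν]
  have hd : ∀ x, 0 < x → HasDerivAt (fun x => x ^ (-σ) * (z x + σ * y x))
      (-(x ^ (-σ - 1) * (x ^ 2 - ν ^ 2 + σ ^ 2) * y x)) x := by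
    intro x hx
    have := (Real.hasDerivAt_rpow_const (p := -σ) (Or.inl hx.ne'))
    refine (this.fun_mul ((h.hz x hx).fun_add ((h.hy x hx).const_mul σ))).congr_deriv ?_
    have e : x ^ (-σ) = x ^ (-σ - 1) * x := by
      rw [Real.rpow_sub_one hx.ne']; field_simp
    rw [e]; field_simp; ring
  obtain ⟨u, ⟨hu1, hu2⟩, hu⟩ := exists_hasDerivAt_eq_zero hst
    (f := fun x => x ^ (-σ) * (z x + σ * y x)) (f' := fun x => -(x ^ (-σ - 1) * (x ^ 2 - ν ^ 2 + σ ^ 2) * y x))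
    (fun x hx => (hd x (by linarith [hx.1])).continuousAt.continuousWithinAt)
    (by simp [h1, h2]) (fun x hx => hd x (by linarith [hx.1]))
  refine ⟨u, hu1, hu2, ?_⟩
  have hu0 : 0 < u := by linarith
  have h3 : 0 < u ^ (-σ - 1) * (u ^ 2 - ν ^ 2 + σ ^ 2) := by
    apply mul_pos (Real.rpow_pos_of_pos hu0 _)
    have : ν ^ 2 < u ^ 2 := by nlinarith
    nlinarith [sq_nonneg σ]
  simpa [h3.ne'] using hu
end
end

section
open Filter Topology

section
variable {ν : ℝ} {y z : ℝ → ℝ}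

lemma phase3 (h : BSys ν y z) {σ : ℝ} (hσ : 0 < σ) :
    ∃ Θ : ℝ → ℝ, ContinuousOn Θ (Set.Ioi ν) ∧
      (∀ x, ν < x → (z x + σ * y x = 0 ↔ Real.sin (Θ x) = 0)) ∧
      (∀ x, ν < x → 0 < z x + σ * y x → Real.sin (Θ x) < 0) ∧
      (∀ x, ν < x → -π < Θ x) ∧
      (∀ x, ν < x → Θ x ≤ psif ν x + π / 4) ∧
      (∀ x, ν < x → |Θ x - (psif ν x - π / 4)| ≤ (σ + 2) / psif ν x) ∧
      (∀ s t, ν < s → s < t → ∀ m n : ℤ, Θ s = m * π → Θ t = n * π → m < n) := by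
  have hν : 0 < ν := by linarith [h.hν]
  obtain ⟨θ, hd, hw, hv, hlow, hup, hup2⟩ := phase2 h
  have hθm : StrictMonoOn θ (Set.Ioi ν) := by
    apply strictMono_of_hd hd
    intro x hx
    have := qf_pos hν hx
    have := rf_pos hν hx
    have := hν.trans hx
    positivity
  set b : ℝ → ℝ := fun x => Real.arctan (bf σ ν x) with hb
  have hb1 : ∀ x, -(π / 2) < b x := fun x => Real.neg_pi_div_two_lt_arctan _
  have hb2 : ∀ x, b x < π / 2 := fun x => Real.arctan_lt_pi_div_two _
  have hbc : ContinuousOn b (Set.Ioi ν) := by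
    have hq : ContinuousOn (qf ν) (Set.Ioi ν) := fun x hx => (qf_hd hν hx).continuousAt.continuousWithinAt
    apply Real.continuous_arctan.comp_continuousOn
    unfold bf
    apply ContinuousOn.sub
    · exact continuousOn_const.div hq (fun x hx => (qf_pos hν hx).ne')
    · apply ContinuousOn.div
      · fun_prop
      · fun_prop
      · intro x hx
        have := qf_pos hν hx
        positivity
  have hphi : ∀ x, ν < x → ∃ K, 0 < K ∧ z x + σ * y x = -(K * Real.sin (θ x - b x)) := by
    intro x hx
    have hs := sf_pos hν hx
    have hP := Real.sqrt_pos.2 (wv_pos h hx)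
    have hcb : 0 < Real.cos (b x) := Real.cos_pos_of_mem_Ioo ⟨hb1 x, hb2 x⟩
    refine ⟨sf ν x * √(wf ν y x ^ 2 + vf ν y z x ^ 2) / Real.cos (b x), by positivity, ?_⟩
    have e1 : z x + σ * y x = sf ν x * (vf ν y z x + bf σ ν x * wf ν y x) := by
      unfold vf bf wf
      rw [← sf_sq hν hx]
      field_simp; ring
    have e2 : bf σ ν x = Real.sin (b x) / Real.cos (b x) := by
      rw [← Real.tan_eq_sin_div_cos, hb]; simp [Real.tan_arctan]
    have hw' := hw x hx
    have hv' := hv x hx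
    set P := √(wf ν y x ^ 2 + vf ν y z x ^ 2) with hPd
    clear_value P
    rw [e1, e2, hw', hv', Real.sin_sub]
    field_simp; ring
  refine ⟨fun x => θ x - b x, ?_, ?_, ?_, ?_, ?_, ?_, ?_⟩
  · exact ContinuousOn.sub (fun x hx => (hd x hx).continuousAt.continuousWithinAt) hbc
  · intro x hx
    obtain ⟨K, hK, e⟩ := hphi x hx
    rw [e, neg_eq_zero, mul_eq_zero]
    exact ⟨fun h => h.resolve_left hK.ne', Or.inr⟩
  · intro x hx hp
    obtain ⟨K, hK, e⟩ := hphi x hx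
    rw [e] at hp
    simp only
    by_contra hc
    push Not at hc
    have := mul_nonneg hK.le hc
    linarith
  · intro x hx
    have := hlow x hx
    have := hb2 x
    simp only; linarith
  · intro x hx
    have := hup x hx
    have := hb1 x
    simp only; linarith
  · intro x hx
    have h1 := hup x hx
    have h2 := hup2 x hx
    have h3 := Ef_le hν hx
    have h4 := (arctan_abs_le (bf σ ν x)).trans (bf_abs hσ hν hx)
    have hp := psif_pos hν hx
    have h5 : 7 / (18 * psif ν x) = (7 / 18) / psif ν x := by field_simp
    have h6 : (σ + 2) / psif ν x = (7 / 18) / psif ν x + (σ + 2 / 3) / psif ν x + (17 / 18) / psif ν x := by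
      field_simp; ring
    have h7 : 0 < (17 / 18) / psif ν x := by positivity
    have h8 : 0 < (7 / 18) / psif ν x := by positivity
    rw [abs_le] at h4 ⊢
    simp only [hb]
    constructor <;> linarith [h4.1, h4.2]
  · intro s t hs hst m n hm hn
    simp only at hm hn
    have ht : ν < t := hs.trans hst
    have z1 : z s + σ * y s = 0 := by
      obtain ⟨K, hK, e⟩ := hphi s hs
      rw [e, hm, Real.sin_int_mul_pi]; simp
    have z2 : z t + σ * y t = 0 := by
      obtain ⟨K, hK, e⟩ := hphi t ht
      rw [e, hn, Real.sin_int_mul_pi]; simp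
    obtain ⟨u, hu1, hu2, hu⟩ := zero_between h hσ hs hst z1 z2
    have huν : ν < u := hs.trans hu1
    have hcu : Real.cos (θ u) = 0 := by
      have := hw u huν
      have hP := Real.sqrt_pos.2 (wv_pos h huν)
      have hw0 : wf ν y u = 0 := by simp [wf, hu]
      have h3 : √(wf ν y u ^ 2 + vf ν y z u ^ 2) * Real.cos (θ u) = 0 := by rw [← this, hw0]
      exact (mul_eq_zero.1 h3).resolve_left hP.ne'
    obtain ⟨j, hj⟩ := Real.cos_eq_zero_iff.1 hcu
    have h1 := hθm hs huν hu1
    have h2 := hθm huν ht hu2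
    have := hb1 s
    have := hb2 t
    have hpi := Real.pi_pos
    have a1 : (m:ℝ) < j + 1 := by
      have : (m:ℝ) * π < (j + 1) * π := by linarith
      exact lt_of_mul_lt_mul_right this hpi.le
    have a2 : (j:ℝ) < n := by
      have : (j:ℝ) * π < n * π := by linarith
      exact lt_of_mul_lt_mul_right this hpi.le
    have a1' : m < j + 1 := by exact_mod_cast a1
    have a2' : j < n := by exact_mod_cast a2
    omega
end
end

section
open Filter Topology

section
variable {ν : ℝ} {y z : ℝ → ℝ}

lemma zc (h : BSys ν y z) {σ : ℝ} (hσ : 0 < σ) (μ : ℝ) (k : ℕ) (hk : 1 ≤ k) :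
    (k ≤ ({t : ℝ | t ∈ Set.Ioc 0 μ ∧ z t + σ * y t = 0}).ncard →
      ν < μ ∧ ((k:ℝ) - 3 / 4) * π - (3 * (σ + 2) + 1) / k ≤ psif ν μ) ∧
    (ν < μ → ((k:ℝ) - 3 / 4) * π + (3 * (σ + 2) + 1) / k ≤ psif ν μ →
      k ≤ ({t : ℝ | t ∈ Set.Ioc 0 μ ∧ z t + σ * y t = 0}).ncard) := by
  have hν : 0 < ν := by linarith [h.hν]
  have hpi := Real.pi_gt_three
  have hpi4 := Real.pi_lt_four
  have hk1 : (1:ℝ) ≤ k := by exact_mod_cast hk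
  obtain ⟨Θ, hc, hz, hpos, hlow, hup, habs, hinj⟩ := phase3 h hσ
  set Z := {t : ℝ | t ∈ Set.Ioc 0 μ ∧ z t + σ * y t = 0} with hZ
  have hZν : ∀ t ∈ Z, ν < t := by
    rintro t ⟨ht, he⟩
    by_contra hcon
    push Not at hcon
    have h1 := h.hG t ht.1 hcon
    have h2 : z t = -(σ * y t) := by linarith
    have h3 : y t = 0 := by
      rw [h2] at h1
      have : σ * (y t) ^ 2 ≤ 0 := by nlinarith
      have : y t ^ 2 ≤ 0 := by
        by_contra hh
        push Not at hh
        have := mul_pos hσ hh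
        linarith
      exact pow_eq_zero_iff two_ne_zero |>.1 (le_antisymm this (sq_nonneg _))
    exact h.hnt t ht.1 h3 (by rw [h2, h3]; ring)
  have hm : ∀ t, ∃ m : ℤ, t ∈ Z → (m:ℝ) * π = Θ t := by
    intro t
    by_cases ht : t ∈ Z
    · obtain ⟨m, hm⟩ := Real.sin_eq_zero_iff.1 ((hz t (hZν t ht)).1 ht.2)
      exact ⟨m, fun _ => hm⟩
    · exact ⟨0, fun h => absurd h ht⟩
  choose m hm using hm
  have hminj : Set.InjOn m Z := by
    intro s hs t ht hst
    by_contra hne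
    rcases lt_or_gt_of_ne hne with hl | hl
    · have := hinj s t (hZν s hs) hl _ _ (hm s hs).symm (hm t ht).symm
      omega
    · have := hinj t s (hZν t ht) hl _ _ (hm t ht).symm (hm s hs).symm
      omega
  have hm0 : ∀ t ∈ Z, 0 ≤ m t := by
    intro t ht
    have h1 := hlow t (hZν t ht)
    rw [← hm t ht] at h1
    have : (-1:ℝ) < m t := by
      by_contra hcon
      push Not at hcon
      nlinarith
    have : (-1:ℤ) < m t := by exact_mod_cast this
    omega
  have hψm : ∀ t ∈ Z, psif ν t ≤ psif ν μ := by
    intro t ht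
    exact (psif_smono hν).monotoneOn (hZν t ht).le ((hZν t ht).le.trans ht.1.2) ht.1.2
  have hfin : Z.Finite := by
    apply Set.Finite.of_finite_image _ hminj
    apply (Set.finite_Icc (0:ℤ) ⌈(psif ν μ + π / 4) / π⌉).subset
    rintro _ ⟨t, ht, rfl⟩
    refine ⟨hm0 t ht, ?_⟩
    have h1 := hup t (hZν t ht)
    have h2 := hψm t ht
    rw [← hm t ht] at h1
    have h3 : (m t : ℝ) ≤ (psif ν μ + π / 4) / π := by
      rw [le_div_iff₀ Real.pi_pos]; linarith
    exact_mod_cast h3.trans (Int.le_ceil _)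
  constructor
  · intro hcard
    obtain ⟨t, ht, hmt⟩ : ∃ t ∈ Z, (k:ℤ) - 1 ≤ m t := by
      by_contra hcon
      push Not at hcon
      have h1 : m '' Z ⊆ (Finset.Ico (0:ℤ) (k - 1) : Set ℤ) := by
        rintro _ ⟨t, ht, rfl⟩
        simp only [Finset.coe_Ico, Set.mem_Ico]
        exact ⟨hm0 t ht, hcon t ht⟩
      have h2 := Set.ncard_le_ncard h1 (Finset.finite_toSet _)
      rw [Set.ncard_image_of_injOn hminj, Set.ncard_coe_finset, Int.card_Ico] at h2
      omega
    have htν := hZν t ht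
    have htμ : t ≤ μ := ht.1.2
    have hp := psif_pos hν htν
    have hle := hψm t ht
    have hmt' : (k:ℝ) - 1 ≤ m t := by
      have : ((k - 1 : ℤ) : ℝ) ≤ m t := by exact_mod_cast hmt
      simpa using this
    have hΘ : ((k:ℝ) - 1) * π ≤ Θ t := by
      rw [← hm t ht]; exact mul_le_mul_of_nonneg_right hmt' Real.pi_pos.le
    refine ⟨by linarith, ?_⟩
    refine le_trans ?_ hle
    rcases hk.eq_or_lt with hk' | hk'
    · rw [← hk']
      simp only [Nat.cast_one, div_one]
      linarith
    · have hk2 : (2:ℝ) ≤ k := by exact_mod_cast hk'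
      have h1 := hup t htν
      have h2 := (abs_le.1 (habs t htν)).2
      have h3 : (k:ℝ) ≤ psif ν t := by nlinarith
      have h4 : (σ + 2) / psif ν t ≤ (σ + 2) / k := by gcongr
      have h5 : (3 * (σ + 2) + 1) / (k:ℝ) = (σ + 2) / k + (2 * (σ + 2) + 1) / k := by ring
      have h6 : 0 < (2 * (σ + 2) + 1) / (k:ℝ) := by positivity
      linarith
  · intro hνμ hψ
    have hp := psif_pos hν hνμ
    have hΘ : ((k:ℝ) - 1) * π ≤ Θ μ := by
      have h2 := (abs_le.1 (habs μ hνμ)).1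
      have h6 : 0 < (3 * (σ + 2) + 1) / (k:ℝ) := by positivity
      have h3 : (k:ℝ) / 2 ≤ psif ν μ := by nlinarith
      have h4 : (σ + 2) / psif ν μ ≤ (σ + 2) / ((k:ℝ) / 2) := by gcongr
      have h5 : (3 * (σ + 2) + 1) / (k:ℝ) = (σ + 2) / ((k:ℝ) / 2) + ((σ + 2) + 1) / k := by field_simp; ring
      have h7 : 0 < ((σ + 2) + 1) / (k:ℝ) := by positivity
      linarith
    obtain ⟨x0, hx0, hx0μ, hneg⟩ : ∃ x0, ν < x0 ∧ x0 < μ ∧ Θ x0 < 0 := by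
      have e1 : ∀ᶠ x in 𝓝[>] ν, 0 < z x + σ * y x := by
        have hcont : ContinuousAt (fun x => z x + σ * y x) ν :=
          (h.hz ν hν).continuousAt.add (continuousAt_const.mul (h.hy ν hν).continuousAt)
        have h0 : 0 < z ν + σ * y ν := by
          have := mul_pos hσ h.hyν
          linarith [h.hzν]
        exact (hcont.eventually (lt_mem_nhds h0)).filter_mono nhdsWithin_le_nhds
      have e2 : ∀ᶠ x in 𝓝[>] ν, psif ν x < π / 4 := by
        have hcw : Tendsto (psif ν) (𝓝[>] ν) (𝓝 (psif ν ν)) :=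
          ((psif_cont hν) ν Set.self_mem_Ici).mono_left (nhdsWithin_mono _ Set.Ioi_subset_Ici_self)
        rw [psif_self hν] at hcw
        exact hcw.eventually (gt_mem_nhds (by positivity))
      have e3 : ∀ᶠ x in 𝓝[>] ν, x < μ := (eventually_lt_nhds hνμ).filter_mono nhdsWithin_le_nhds
      have e4 : ∀ᶠ x in 𝓝[>] ν, ν < x := self_mem_nhdsWithin
      obtain ⟨x, h1, h2, h3, h4⟩ := (e1.and (e2.and (e3.and e4))).exists
      refine ⟨x, h4, h3, ?_⟩
      have hs := hpos x h4 h1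
      by_contra hcon
      push Not at hcon
      have h5 := hup x h4
      have := Real.sin_nonneg_of_nonneg_of_le_pi hcon (by linarith)
      linarith
    have hex : ∀ i : ℕ, ∃ t, i < k → (t ∈ Z ∧ Θ t = i * π) := by
      intro i
      by_cases hi : i < k
      · have hi' : (i:ℝ) ≤ k - 1 := by
          have : (i:ℝ) + 1 ≤ k := by exact_mod_cast hi
          linarith
        have hcI : ContinuousOn Θ (Set.Icc x0 μ) := hc.mono (fun t ht => hx0.trans_le ht.1)
        obtain ⟨t, ht, hte⟩ := intermediate_value_Icc hx0μ.le hcI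
          (show (i:ℝ) * π ∈ Set.Icc (Θ x0) (Θ μ) from ⟨by
            have : 0 ≤ (i:ℝ) * π := by positivity
            linarith, (mul_le_mul_of_nonneg_right hi' Real.pi_pos.le).trans hΘ⟩)
        refine ⟨t, fun _ => ⟨⟨⟨by linarith [ht.1], ht.2⟩, ?_⟩, hte⟩⟩
        rw [hz t (by linarith [ht.1]), hte]
        exact Real.sin_nat_mul_pi i
      · exact ⟨0, fun h => absurd h hi⟩
    choose f hf using hex
    apply Set.le_ncard_of_inj_on_range f (fun i hi => (hf i hi).1) _ hfin
    intro i hi j hj hij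
    have h1 := (hf i hi).2
    have h2 := (hf j hj).2
    rw [hij, h2] at h1
    have := mul_right_cancel₀ Real.pi_pos.ne' h1
    exact_mod_cast this.symm
end

lemma zero_count {σ : ℝ} (hσ : 0 < σ) (n : ℕ) (hn : 1 ≤ n) (μ : ℝ) (k : ℕ) (hk : 1 ≤ k) :
    (k ≤ ({t : ℝ | t ∈ Set.Ioc 0 μ ∧ phiRobin σ n t = 0}).ncard →
      (n:ℝ) < μ ∧ ((k:ℝ) - 3 / 4) * π - (3 * (σ + 2) + 1) / k ≤ psif n μ) ∧
    ((n:ℝ) < μ → ((k:ℝ) - 3 / 4) * π + (3 * (σ + 2) + 1) / k ≤ psif n μ →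
      k ≤ ({t : ℝ | t ∈ Set.Ioc 0 μ ∧ phiRobin σ n t = 0}).ncard) := by
  obtain ⟨ε, hε, hB⟩ := bessel_BSys n hn
  have := zc hB hσ μ k hk
  have e : {t : ℝ | t ∈ Set.Ioc 0 μ ∧ phiRobin σ n t = 0} =
      {t : ℝ | t ∈ Set.Ioc 0 μ ∧ (fun x => ε * (x * bJ1 n x)) t + σ * (fun x => ε * besselJ n x) t = 0} := by
    ext t
    simp only [Set.mem_setOf_eq, phi_eq]
    rw [show ε * (t * bJ1 n t) + σ * (ε * besselJ n t) = ε * (t * bJ1 n t + σ * besselJ n t) by ring]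
    simp [hε]
  rw [e]; exact this
end

section
open Filter Topology

lemma sub_le_cube {a : ℝ} (ha : 0 ≤ a) : Real.sin a - a * Real.cos a ≤ a ^ 3 / 3 := by
  have hd : ∀ x, HasDerivAt (fun x => x ^ 3 / 3 - (Real.sin x - x * Real.cos x)) (x ^ 2 - x * Real.sin x) x := by
    intro x
    refine ((((hasDerivAt_id x).fun_pow 3).div_const 3).fun_sub ((Real.hasDerivAt_sin x).fun_sub
      ((hasDerivAt_id x).fun_mul (Real.hasDerivAt_cos x)))).congr_deriv ?_
    simp
  have hm : MonotoneOn (fun x => x ^ 3 / 3 - (Real.sin x - x * Real.cos x)) (Set.Ici 0) := by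
    apply monotoneOn_of_deriv_nonneg (convex_Ici 0)
    · intro x _; exact (hd x).continuousAt.continuousWithinAt
    · intro x _; exact (hd x).differentiableAt.differentiableWithinAt
    · intro x hx
      rw [interior_Ici] at hx
      have hx' : 0 < x := hx
      rw [(hd x).deriv]
      have := Real.sin_le hx'.le
      nlinarith
  have := hm Set.self_mem_Ici (Set.mem_Ici.2 ha) ha
  simp at this
  linarith

lemma cube_le_sub {a : ℝ} (ha : 0 ≤ a) (ha2 : a ≤ π / 2) : 2 / (3 * π) * a ^ 3 ≤ Real.sin a - a * Real.cos a := by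
  have hd : ∀ x, HasDerivAt (fun x => (Real.sin x - x * Real.cos x) - 2 / (3 * π) * x ^ 3)
      (x * Real.sin x - 2 / π * x ^ 2) x := by
    intro x
    refine (((Real.hasDerivAt_sin x).fun_sub
      ((hasDerivAt_id x).fun_mul (Real.hasDerivAt_cos x))).fun_sub (((hasDerivAt_id x).fun_pow 3).const_mul (2 / (3 * π)))).congr_deriv ?_
    simp; field_simp
  have hm : MonotoneOn (fun x => (Real.sin x - x * Real.cos x) - 2 / (3 * π) * x ^ 3) (Set.Icc 0 (π / 2)) := by
    apply monotoneOn_of_deriv_nonneg (convex_Icc _ _)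
    · intro x _; exact (hd x).continuousAt.continuousWithinAt
    · intro x _; exact (hd x).differentiableAt.differentiableWithinAt
    · intro x hx
      have hx := interior_subset hx
      rw [(hd x).deriv]
      have := Real.mul_le_sin hx.1 hx.2
      have := mul_le_mul_of_nonneg_left this hx.1
      nlinarith
  have := hm ⟨le_rfl, by positivity⟩ ⟨ha, ha2⟩ ha
  simp at this
  linarith

lemma psif_trig {ν μ : ℝ} (hν : 0 < ν) (h : ν < μ) :
    psif ν μ = μ * (Real.sin (Real.arccos (ν / μ)) - Real.arccos (ν / μ) * Real.cos (Real.arccos (ν / μ))) := by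
  have hμ := hν.trans h
  have h1 : ν / μ ≤ 1 := by rw [div_le_one hμ]; exact h.le
  have h0 : 0 < ν / μ := by positivity
  rw [Real.cos_arccos (by linarith) h1, Real.sin_arccos]
  have e : √(1 - (ν / μ) ^ 2) = qf ν μ / μ := by
    rw [show 1 - (ν / μ) ^ 2 = (qf ν μ / μ) ^ 2 by rw [div_pow, div_pow, qf_sq hν h.le]; field_simp]
    exact Real.sqrt_sq (div_nonneg (qf_pos hν h).le hμ.le)
  rw [e]; unfold psif; field_simp

lemma mem_iff {n μ κ : ℝ} (hn : 0 < n) (hμ : 0 < μ) (hκ : 0 < κ) :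
    (n, κ) ∈ μ • domD ↔ n < μ ∧ κ * π ≤ psif n μ := by
  have hpi := Real.pi_pos
  rw [Set.mem_smul_set_iff_inv_smul_mem₀ hμ.ne']
  have e0 : μ⁻¹ • (n, κ) = (n / μ, κ / μ) := by
    ext <;> simp <;> ring
  rw [e0]
  have h0 : 0 < n / μ := by positivity
  have key : n ≤ μ → (κ / μ ≤ gfun (n / μ) ↔ κ * π ≤ psif n μ) := by
    intro h
    have e : √(1 - (n / μ) ^ 2) = qf n μ / μ := by
      rw [show 1 - (n / μ) ^ 2 = (qf n μ / μ) ^ 2 by rw [div_pow, div_pow, qf_sq hn h]; field_simp]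
      exact Real.sqrt_sq (div_nonneg (Real.sqrt_nonneg _) hμ.le)
    have e2 : gfun (n / μ) = psif n μ / π / μ := by
      unfold gfun; rw [e]; unfold psif; field_simp
    rw [e2, div_le_div_iff_of_pos_right hμ, le_div_iff₀ hpi]
  constructor
  · rintro ⟨h1, h2, h3, h4⟩
    simp only at h1 h2 h3 h4
    rw [div_le_one hμ] at h2
    have h5 := (key h2).1 h4
    refine ⟨lt_of_le_of_ne h2 ?_, h5⟩
    rintro rfl
    rw [psif_self hn] at h5
    have := mul_pos hκ hpi
    linarith
  · rintro ⟨h1, h2⟩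
    refine ⟨by simp only; linarith, by simp only; rw [div_le_one hμ]; exact h1.le, ?_, ?_⟩
    · simp only
      apply max_le
      · positivity
      · have : 0 < κ / μ := by positivity
        linarith
    · simp only
      exact (key h1.le).2 h2

lemma psif_gap {n m μ : ℝ} (hn : 0 < n) (hnm : n < m) (hm : m < μ) :
    (m - n) * Real.arccos (m / μ) ≤ psif n μ - psif m μ := by
  have hμ : 0 < μ := by linarith
  set ϑ := Real.arccos (m / μ) with hϑ
  have hd : ∀ ν, 0 < ν → ν < μ → HasDerivAt (fun ν => psif ν μ + ν * ϑ) (-Real.arccos (ν / μ) + ϑ) ν := by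
    intro ν h0 h1
    have hq := qf_pos h0 h1
    have d1 : HasDerivAt (fun ν => qf ν μ) (-(ν / qf ν μ)) ν := by
      have h : HasDerivAt (fun ν : ℝ => μ ^ 2 - ν ^ 2) (-(2 * ν)) ν := by
        simpa using ((hasDerivAt_id ν).fun_pow 2).const_sub (μ ^ 2)
      have hp : 0 < μ ^ 2 - ν ^ 2 := by nlinarith
      refine (h.sqrt hp.ne').congr_deriv ?_
      unfold qf at hq ⊢
      field_simp
    have hlt : ν / μ < 1 := by rw [div_lt_one hμ]; exact h1
    have hgt : 0 < ν / μ := by positivity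
    have d2 := (Real.hasDerivAt_arccos (by linarith : ν / μ ≠ -1) hlt.ne).comp ν ((hasDerivAt_id ν).div_const μ)
    have e : √(1 - (ν / μ) ^ 2) = qf ν μ / μ := by
      rw [show 1 - (ν / μ) ^ 2 = (qf ν μ / μ) ^ 2 by rw [div_pow, div_pow, qf_sq h0 h1.le]; field_simp]
      exact Real.sqrt_sq (div_nonneg hq.le hμ.le)
    refine ((d1.fun_sub ((hasDerivAt_id ν).fun_mul d2)).fun_add ((hasDerivAt_id ν).mul_const ϑ)).congr_deriv ?_
    simp only [id, e, Function.comp]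
    field_simp
    ring
  have ha : AntitoneOn (fun ν => psif ν μ + ν * ϑ) (Set.Icc n m) := by
    apply antitoneOn_of_deriv_nonpos (convex_Icc _ _)
    · intro x hx; exact (hd x (by linarith [hx.1]) (by linarith [hx.2])).continuousAt.continuousWithinAt
    · intro x hx; have hx := interior_subset hx
      exact (hd x (by linarith [hx.1]) (by linarith [hx.2])).differentiableAt.differentiableWithinAt
    · intro x hx; have hx := interior_subset hx
      rw [(hd x (by linarith [hx.1]) (by linarith [hx.2])).deriv]
      have : ϑ ≤ Real.arccos (x / μ) := Real.antitone_arccos (by gcongr; exact hx.2)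
      linarith
  have := ha (Set.left_mem_Icc.2 hnm.le) (Set.right_mem_Icc.2 hnm.le) hnm.le
  simp only at this
  linarith

/-- spread bound, main case -/
lemma spread1 {n m M K C1 lo : ℝ} (hn : 0 < n) (hnm : n < m) (hm : m < M ^ 3) (hM : 0 < M) (hK : 0 < K)
    (hlo : K ^ 3 / 3 ≤ lo) (h1 : lo ≤ psif m (M ^ 3)) (h2 : psif n (M ^ 3) ≤ lo + C1 / K ^ 3) :
    m - n ≤ C1 * (M / K ^ 4) := by
  have hg := psif_gap hn hnm hm
  have hm0 : 0 < m := hn.trans hnm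
  set ϑ := Real.arccos (m / M ^ 3) with hϑ
  have hϑ0 : 0 ≤ ϑ := Real.arccos_nonneg _
  have ht := psif_trig hm0 hm
  have hc := sub_le_cube hϑ0
  have h3 : K ^ 3 ≤ (M * ϑ) ^ 3 := by
    have := mul_le_mul_of_nonneg_left hc (by positivity : 0 ≤ M ^ 3)
    rw [← ht] at this
    nlinarith
  have h4 : K ≤ M * ϑ := le_of_pow_le_pow_left₀ (by norm_num) (by positivity) h3
  have h5 : (m - n) * ϑ ≤ C1 / K ^ 3 := by linarith
  rw [le_div_iff₀ (by positivity)] at h5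
  rw [mul_div_assoc', le_div_iff₀ (by positivity)]
  have h6 : (m - n) * K ^ 4 ≤ (m - n) * K ^ 3 * (M * ϑ) := by
    have : 0 ≤ (m - n) * K ^ 3 := mul_nonneg (by linarith) (by positivity)
    have := mul_le_mul_of_nonneg_left h4 this
    linarith
  have h7 := mul_le_mul_of_nonneg_left h5 hM.le
  linarith

/-- spread bound, small rows -/
lemma spread2 {n M B : ℝ} (hn : 0 < n) (hm : n < M ^ 3) (hM : 0 < M) (hB : 1 ≤ B)
    (h2 : psif n (M ^ 3) ≤ B) : M ^ 3 - n ≤ 6 * B * M := by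
  have ht := psif_trig hn hm
  set α := Real.arccos (n / M ^ 3) with hα
  have hα0 : 0 ≤ α := Real.arccos_nonneg _
  have hM3 : 0 < M ^ 3 := by positivity
  have hα1 : α ≤ π / 2 := Real.arccos_le_pi_div_two.2 (by positivity)
  have hc := cube_le_sub hα0 hα1
  have hcos : M ^ 3 * Real.cos α = n := by
    rw [hα, Real.cos_arccos]
    · field_simp
    · have : 0 < n / M ^ 3 := by positivity
      linarith
    · rw [div_le_one hM3]; exact hm.le
  have h1 : 1 - α ^ 2 / 2 ≤ Real.cos α := Real.one_sub_sq_div_two_le_cos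
  have h3 : M ^ 3 - n ≤ M ^ 3 * (α ^ 2 / 2) := by rw [← hcos]; nlinarith
  have h4 : (M * α) ^ 3 ≤ 6 * B := by
    have := mul_le_mul_of_nonneg_left hc hM3.le
    rw [← ht] at this
    have h5 : 1 / 6 ≤ 2 / (3 * π) := by
      rw [div_le_div_iff₀ (by norm_num) (by positivity)]
      linarith [Real.pi_lt_four]
    have h6 := mul_le_mul_of_nonneg_right h5 (by positivity : 0 ≤ M ^ 3 * α ^ 3)
    rw [mul_pow]
    nlinarith
  have hβ : 0 ≤ M * α := by positivity
  have h5 : (M * α) ^ 2 ≤ 6 * B := by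
    rcases le_total 1 (M * α) with h | h
    · nlinarith [sq_nonneg (M * α)]
    · nlinarith
  have h6 : M ^ 3 * (α ^ 2 / 2) = M * (M * α) ^ 2 / 2 := by ring
  have := mul_le_mul_of_nonneg_left h5 hM.le
  have h7 : 0 ≤ M * (M * α) ^ 2 := by positivity
  linarith

lemma ncard_spread {S : Set ℤ} {R : ℝ} (hR : 0 ≤ R) (hf : S.Finite)
    (h : ∀ n ∈ S, ∀ m ∈ S, n < m → ((m:ℝ) - n) ≤ R) : (S.ncard : ℝ) ≤ R + 1 := by
  rcases S.eq_empty_or_nonempty with rfl | hne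
  · simp; linarith
  obtain ⟨a, ha, hamin⟩ := Set.exists_min_image S id hf hne
  obtain ⟨b, hb, hbmax⟩ := Set.exists_max_image S id hf hne
  have hsub : S ⊆ (Finset.Icc a b : Set ℤ) := by
    intro x hx
    simp only [Finset.coe_Icc, Set.mem_Icc]
    exact ⟨hamin x hx, hbmax x hx⟩
  have h1 := Set.ncard_le_ncard hsub (Finset.finite_toSet _)
  rw [Set.ncard_coe_finset, Int.card_Icc] at h1
  have hab : a ≤ b := hamin b hb
  have h2 : ((b:ℝ) - a) ≤ R := by
    rcases hab.eq_or_lt with rfl | hl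
    · simpa using hR
    · exact h a ha b hb hl
  have h3 : (S.ncard : ℤ) ≤ b + 1 - a := by omega
  have h4 : (S.ncard : ℝ) ≤ b + 1 - a := by exact_mod_cast h3
  linarith
end

/-- Fix `σ > 0`. There exists `c₀ > 0` such that for every `c ≥ c₀` there is `C > 0` with
`N_k(μ) − C μ^{1/3} k^{−4/3} − 1 ≤ N_k′(μ) ≤ N_k(μ) + C μ^{1/3} k^{−4/3} + 1`
for all integers `k ≥ 1` and all `μ ≥ 1`. -/
theorem disk_row_count_comparison (σ : ℝ) (hσ : 0 < σ) :
    ∃ c₀ : ℝ, 0 < c₀ ∧ ∀ c : ℝ, c₀ ≤ c → ∃ C : ℝ, 0 < C ∧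
      ∀ k : ℕ, 1 ≤ k → ∀ μ : ℝ, 1 ≤ μ →
        (latticeCountRow c k μ : ℝ) - C * μ ^ ((1:ℝ)/3) * (k : ℝ) ^ (-(4:ℝ)/3) - 1
            ≤ (diskRobinCountRow σ c k μ : ℝ) ∧
        (diskRobinCountRow σ c k μ : ℝ)
            ≤ (latticeCountRow c k μ : ℝ) + C * μ ^ ((1:ℝ)/3) * (k : ℝ) ^ (-(4:ℝ)/3) + 1 := by
  set C1 : ℝ := 3 * (σ + 2) + 1 with hC1
  have hC1g : 1 ≤ C1 := by linarith
  refine ⟨1, one_pos, fun c hc => ⟨648 * C1 ^ 3, by positivity, ?_⟩⟩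
  intro k hk μ hμ
  have hk1 : (1:ℝ) ≤ k := by exact_mod_cast hk
  have hk0 : (0:ℝ) < k := by linarith
  have hμ0 : 0 < μ := by linarith
  have hpi := Real.pi_gt_three
  have hpi4 := Real.pi_lt_four
  obtain ⟨M, hMd⟩ : ∃ M, M = μ ^ ((1:ℝ)/3) := ⟨_, rfl⟩
  obtain ⟨K, hKd⟩ : ∃ K, K = (k:ℝ) ^ ((1:ℝ)/3) := ⟨_, rfl⟩
  have hM : 0 < M := by rw [hMd]; positivity
  have hK1 : 1 ≤ K := by rw [hKd]; exact Real.one_le_rpow hk1 (by norm_num)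
  have hK : 0 < K := by linarith
  have hM3 : M ^ 3 = μ := by
    rw [hMd, ← Real.rpow_natCast, ← Real.rpow_mul hμ0.le]; norm_num
  have hK3 : K ^ 3 = k := by
    rw [hKd, ← Real.rpow_natCast, ← Real.rpow_mul hk0.le]; norm_num
  have hK4 : (k:ℝ) ^ (-(4:ℝ)/3) = 1 / K ^ 4 := by
    rw [hKd, ← Real.rpow_natCast, ← Real.rpow_mul hk0.le, one_div, ← Real.rpow_neg hk0.le]; norm_num
  have hR : 648 * C1 ^ 3 * μ ^ ((1:ℝ)/3) * (k : ℝ) ^ (-(4:ℝ)/3) = 648 * C1 ^ 3 * (M / K ^ 4) := by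
    rw [hK4, ← hMd]; ring
  rw [hR]
  set R := 648 * C1 ^ 3 * (M / K ^ 4) with hRd
  have hR0 : 0 ≤ R := by positivity
  have hC1R : C1 * (M / K ^ 4) ≤ R := by
    apply mul_le_mul_of_nonneg_right _ (by positivity)
    nlinarith [mul_self_nonneg (C1 - 1), pow_le_pow_left₀ (by norm_num) hC1g 2]
  set A : Set ℤ := {n : ℤ | c * (k : ℝ) ≤ (n : ℝ) ∧ ((n : ℝ), (k : ℝ) - 3/4) ∈ μ • domD} with hA
  set A' : Set ℤ := {n : ℤ | c * (k : ℝ) ≤ (n : ℝ) ∧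
    k ≤ ({t : ℝ | t ∈ Set.Ioc 0 μ ∧ phiRobin σ n.natAbs t = 0}).ncard} with hA'
  change (A.ncard : ℝ) - R - 1 ≤ (A'.ncard : ℝ) ∧ (A'.ncard : ℝ) ≤ A.ncard + R + 1
  have hn1 : ∀ n : ℤ, c * (k:ℝ) ≤ n → (1:ℝ) ≤ n := by
    intro n hn; nlinarith
  have hmemA : ∀ n : ℤ, c * (k:ℝ) ≤ n → (n ∈ A ↔ (n:ℝ) < μ ∧ ((k:ℝ) - 3 / 4) * π ≤ psif n μ) := by
    intro n hn
    have h1 := hn1 n hn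
    rw [← mem_iff (by linarith) hμ0 (by linarith : (0:ℝ) < (k:ℝ) - 3 / 4)]
    exact ⟨fun h => h.2, fun h => ⟨hn, h⟩⟩
  have hzc : ∀ n : ℤ, c * (k:ℝ) ≤ n →
      (n ∈ A' → (n:ℝ) < μ ∧ ((k:ℝ) - 3 / 4) * π - C1 / k ≤ psif n μ) ∧
      ((n:ℝ) < μ → ((k:ℝ) - 3 / 4) * π + C1 / k ≤ psif n μ → n ∈ A') := by
    intro n hn
    have h1 := hn1 n hn
    have h1' : 1 ≤ n := by exact_mod_cast h1
    have hz := zero_count hσ n.natAbs (by omega) μ k hk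
    have e : ((n.natAbs : ℕ) : ℝ) = n := by
      rw [Nat.cast_natAbs, abs_of_nonneg (by omega)]
    rw [e] at hz
    exact ⟨fun h => hz.1 h.2, fun h2 h3 => ⟨hn, hz.2 h2 h3⟩⟩
  have hfin : ∀ S : Set ℤ, (∀ n ∈ S, (1:ℝ) ≤ n ∧ (n:ℝ) < μ) → S.Finite := by
    intro S hS
    apply (Set.finite_Icc (1:ℤ) ⌈μ⌉).subset
    intro n hn
    obtain ⟨h1, h2⟩ := hS n hn
    exact ⟨by exact_mod_cast h1, by exact_mod_cast h2.le.trans (Int.le_ceil μ)⟩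
  have hAb : ∀ n ∈ A, (1:ℝ) ≤ n ∧ (n:ℝ) < μ := fun n hn =>
    ⟨hn1 n hn.1, ((hmemA n hn.1).1 hn).1⟩
  have hA'b : ∀ n ∈ A', (1:ℝ) ≤ n ∧ (n:ℝ) < μ := fun n hn =>
    ⟨hn1 n hn.1, ((hzc n hn.1).1 hn).1⟩
  have hδ : 0 < C1 / k := by positivity
  have ha : 3 * (k:ℝ) / 4 ≤ ((k:ℝ) - 3 / 4) * π := by nlinarith
  have hS1 : ((A \ A').ncard : ℝ) ≤ R + 1 := by
    apply ncard_spread hR0 (hfin _ fun n hn => hAb n hn.1)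
    intro n hn m hm hnm
    have hnm' : (n:ℝ) < m := by exact_mod_cast hnm
    have hnA := (hmemA n hn.1.1).1 hn.1
    have hmA := (hmemA m hm.1.1).1 hm.1
    have h2 : psif n μ < ((k:ℝ) - 3 / 4) * π + C1 / k := by
      by_contra hcon
      push Not at hcon
      exact hn.2 ((hzc n hn.1.1).2 hnA.1 hcon)
    refine le_trans ?_ hC1R
    apply spread1 (lo := ((k:ℝ) - 3 / 4) * π) (by linarith [hn1 n hn.1.1]) hnm' (by rw [hM3]; exact hmA.1) hM hK
    · rw [hK3]; linarith
    · rw [hM3]; exact hmA.2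
    · rw [hM3, hK3]; exact h2.le
  have hS2 : ((A' \ A).ncard : ℝ) ≤ R + 1 := by
    apply ncard_spread hR0 (hfin _ fun n hn => hA'b n hn.1)
    intro n hn m hm hnm
    have hnm' : (n:ℝ) < m := by exact_mod_cast hnm
    have hnA := (hzc n hn.1.1).1 hn.1
    have hmA := (hzc m hm.1.1).1 hm.1
    have h2 : psif n μ < ((k:ℝ) - 3 / 4) * π := by
      by_contra hcon
      push Not at hcon
      exact hn.2 ((hmemA n hn.1.1).2 ⟨hnA.1, hcon⟩)
    have hn0 : (0:ℝ) < n := by linarith [hn1 n hn.1.1]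
    rcases le_total (3 * C1) k with hbig | hsmall
    · refine le_trans ?_ hC1R
      have hq : C1 / k ≤ 1 / 3 := by
        rw [div_le_iff₀ hk0]; linarith
      apply spread1 (lo := ((k:ℝ) - 3 / 4) * π - C1 / k) hn0 hnm' (by rw [hM3]; exact hmA.1) hM hK
      · rw [hK3]; linarith
      · rw [hM3]; exact hmA.2
      · rw [hM3, hK3]; linarith
    · have hB : psif n (M ^ 3) ≤ 12 * C1 := by
        rw [hM3]; nlinarith
      have h3 := spread2 hn0 (by rw [hM3]; exact hnA.1) hM (by linarith) hB
      have h4 : (m:ℝ) - n ≤ 72 * C1 * M := by rw [hM3] at h3; linarith [hmA.1]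
      refine h4.trans ?_
      have h5 : K ^ 4 ≤ 9 * C1 ^ 2 := by
        calc K ^ 4 ≤ K ^ 6 := pow_le_pow_right₀ hK1 (by norm_num)
          _ = (K ^ 3) ^ 2 := by ring
          _ ≤ (3 * C1) ^ 2 := by rw [hK3]; exact pow_le_pow_left₀ hk0.le hsmall 2
          _ = _ := by ring
      rw [hRd, mul_div_assoc', le_div_iff₀ (by positivity)]
      have := mul_le_mul_of_nonneg_left h5 (by positivity : 0 ≤ 72 * C1 * M)
      linarith
  have h1 := Set.ncard_le_ncard_diff_add_ncard A A' (hfin _ hA'b)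
  have h2 := Set.ncard_le_ncard_diff_add_ncard A' A (hfin _ hAb)
  have h1' : (A.ncard : ℝ) ≤ (A \ A').ncard + A'.ncard := by exact_mod_cast h1
  have h2' : (A'.ncard : ℝ) ≤ (A' \ A).ncard + A.ncard := by exact_mod_cast h2
  constructor <;> linarith
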